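/- arXiv:1502.00336 — 2 statements merged into one kernel-verified Lean document; each statement's English description precedes it below -/
import Mathlib

section
/- Let u ∈ C²(Q̄_T) be an admissible solution of equation (E) with u = φ on 𝒫Q_T and u ≥ u̲ on Q̄_T, where u̲ satisfies (sub) and u̲ = φ on ∂Ω × [0,T]. Assume (A2) and (A4). Then there exists a constant C > 0, depending only on n, Ω, T, A, ψ, φ and u̲, such that max_{Q̄_T} |u| + max_{𝒫Q_T} |Du| ≤ C. -/
open scoped BigOperators Topology

noncomputable section

namespace ParabolicHessian

/-- Square real matrices of size `n`. -/
abbrev Mat (n : ℕ) := Matrix (Fin n) (Fin n) ℝ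

/-- Eigenvalue vector of a real matrix (junk value `0` if not symmetric). -/
def eigenVec {n : ℕ} (S : Mat n) : Fin n → ℝ :=
  if h : S.IsHermitian then h.eigenvalues else 0

/-- Spatial gradient of `v : ℝⁿ → ℝ`. -/
def sgrad {n : ℕ} (v : (Fin n → ℝ) → ℝ) (x : Fin n → ℝ) : Fin n → ℝ :=
  fun i => fderiv ℝ v x (Pi.single i 1)

/-- Spatial Hessian of `v : ℝⁿ → ℝ`, as a matrix. -/
def shess {n : ℕ} (v : (Fin n → ℝ) → ℝ) (x : Fin n → ℝ) : Mat n :=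
  Matrix.of fun i j => fderiv ℝ (fun y => fderiv ℝ v y (Pi.single j 1)) x (Pi.single i 1)

/-- Quadratic form `ξᵀ S ξ`. -/
def qform {n : ℕ} (S : Mat n) (ξ : Fin n → ℝ) : ℝ :=
  ∑ i, ∑ j, ξ i * S i j * ξ j

/-- Norm of a matrix (sup norm on `Fin n → Fin n → ℝ`). -/
def matNorm {n : ℕ} (S : Mat n) : ℝ := ‖(fun i j => S i j : Fin n → Fin n → ℝ)‖

/-- The parabolic cylinder `Q_T = Ω × (0,T]`. -/
def QT {n : ℕ} (Ω : Set (Fin n → ℝ)) (T : ℝ) : Set ((Fin n → ℝ) × ℝ) :=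
  Ω ×ˢ Set.Ioc 0 T

/-- `Q̄_T = Ω̄ × [0,T]`. -/
def QTbar {n : ℕ} (Ω : Set (Fin n → ℝ)) (T : ℝ) : Set ((Fin n → ℝ) × ℝ) :=
  closure Ω ×ˢ Set.Icc 0 T

/-- The parabolic boundary `𝒫Q_T = (Ω̄ × {0}) ∪ (∂Ω × [0,T])`. -/
def PQ {n : ℕ} (Ω : Set (Fin n → ℝ)) (T : ℝ) : Set ((Fin n → ℝ) × ℝ) :=
  (closure Ω ×ˢ ({0} : Set ℝ)) ∪ (frontier Ω ×ˢ Set.Icc 0 T)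

/-- `Ω` has smooth boundary (encoded via a smooth defining function). -/
def SmoothBoundary {n : ℕ} (Ω : Set (Fin n → ℝ)) : Prop :=
  ∃ ρ : (Fin n → ℝ) → ℝ, ContDiff ℝ (⊤ : ℕ∞) ρ ∧ Ω = {x | ρ x < 0} ∧
    ∀ x ∈ frontier Ω, fderiv ℝ ρ x ≠ 0

/-- `Γ` is an open convex symmetric proper cone with vertex `0`
containing the positive cone. -/
def GoodCone {n : ℕ} (Γ : Set (Fin n → ℝ)) : Prop :=
  IsOpen Γ ∧ Convex ℝ Γ ∧ (∀ lam ∈ Γ, ∀ s : ℝ, 0 < s → s • lam ∈ Γ) ∧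
    (∀ σ : Equiv.Perm (Fin n), ∀ lam ∈ Γ, lam ∘ σ ∈ Γ) ∧
    {lam : Fin n → ℝ | ∀ i, 0 < lam i} ⊆ Γ ∧ Γ ≠ Set.univ

/-- `f` is smooth and symmetric on `Γ`. -/
def SmoothSymF {n : ℕ} (Γ : Set (Fin n → ℝ)) (f : (Fin n → ℝ) → ℝ) : Prop :=
  ContDiffOn ℝ (⊤ : ℕ∞) f Γ ∧ ∀ σ : Equiv.Perm (Fin n), ∀ lam ∈ Γ, f (lam ∘ σ) = f lam

/-- `f_i = ∂f/∂λ_i`. -/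
def fLam {n : ℕ} (f : (Fin n → ℝ) → ℝ) (lam : Fin n → ℝ) (i : Fin n) : ℝ :=
  fderiv ℝ f lam (Pi.single i 1)

/-- (f1): `∂f/∂λ_i > 0` on `Γ`. -/
def F1cond {n : ℕ} (Γ : Set (Fin n → ℝ)) (f : (Fin n → ℝ) → ℝ) : Prop :=
  ∀ lam ∈ Γ, ∀ i, 0 < fLam f lam i

/-- (f2): `f` is concave on `Γ`. -/
def F2cond {n : ℕ} (Γ : Set (Fin n → ℝ)) (f : (Fin n → ℝ) → ℝ) : Prop :=
  ConcaveOn ℝ Γ f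

/-- (f5): `f > 0` on `Γ` and `f → 0` at every boundary point of `Γ`. -/
def F5cond {n : ℕ} (Γ : Set (Fin n → ℝ)) (f : (Fin n → ℝ) → ℝ) : Prop :=
  (∀ lam ∈ Γ, 0 < f lam) ∧
    ∀ lam₀ ∈ frontier Γ, Filter.Tendsto f (nhdsWithin lam₀ Γ) (nhds 0)

/-- `A(x,t,p)` is a smooth symmetric-matrix-valued function. -/
def ASmooth {n : ℕ} (A : (Fin n → ℝ) → ℝ → (Fin n → ℝ) → Mat n) : Prop :=
  (∀ x t p, (A x t p).IsSymm) ∧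
    ∀ i j, ContDiff ℝ (⊤ : ℕ∞)
      (fun q : ((Fin n → ℝ) × ℝ) × (Fin n → ℝ) => A q.1.1 q.1.2 q.2 i j)

/-- `ψ(x,t,z,p)` is smooth. -/
def PsiSmooth {n : ℕ} (ψ : (Fin n → ℝ) → ℝ → ℝ → (Fin n → ℝ) → ℝ) : Prop :=
  ContDiff ℝ (⊤ : ℕ∞)
    (fun q : ((Fin n → ℝ) × ℝ) × ℝ × (Fin n → ℝ) => ψ q.1.1 q.1.2 q.2.1 q.2.2)

/-- `u ∈ C^k`, jointly in `(x,t)`. -/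
def RegN {n : ℕ} (k : ℕ) (u : (Fin n → ℝ) → ℝ → ℝ) : Prop :=
  ContDiff ℝ (k : ℕ∞) fun q : (Fin n → ℝ) × ℝ => u q.1 q.2

/-- `u ∈ C^∞`, jointly in `(x,t)`. -/
def RegInf {n : ℕ} (u : (Fin n → ℝ) → ℝ → ℝ) : Prop :=
  ContDiff ℝ (⊤ : ℕ∞) fun q : (Fin n → ℝ) × ℝ => u q.1 q.2

/-- `U[u] = D²u + A(x,t,Du)`. -/
def Umat {n : ℕ} (A : (Fin n → ℝ) → ℝ → (Fin n → ℝ) → Mat n)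
    (u : (Fin n → ℝ) → ℝ → ℝ) (x : Fin n → ℝ) (t : ℝ) : Mat n :=
  shess (fun y => u y t) x + A x t (sgrad (fun y => u y t) x)

/-- `u` is admissible on `Q`: `λ(U[u]) ∈ Γ` on `Q`. -/
def Admissible {n : ℕ} (Γ : Set (Fin n → ℝ))
    (A : (Fin n → ℝ) → ℝ → (Fin n → ℝ) → Mat n)
    (u : (Fin n → ℝ) → ℝ → ℝ) (Q : Set ((Fin n → ℝ) × ℝ)) : Prop :=
  ∀ q ∈ Q, eigenVec (Umat A u q.1 q.2) ∈ Γ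

/-- Equation (E): `f(λ(D²u + A(x,t,Du))) − ∂ₜu = ψ(x,t,u,Du)` on `Q`. -/
def SolvesE {n : ℕ} (f : (Fin n → ℝ) → ℝ)
    (A : (Fin n → ℝ) → ℝ → (Fin n → ℝ) → Mat n)
    (ψ : (Fin n → ℝ) → ℝ → ℝ → (Fin n → ℝ) → ℝ)
    (u : (Fin n → ℝ) → ℝ → ℝ) (Q : Set ((Fin n → ℝ) × ℝ)) : Prop :=
  ∀ q ∈ Q, f (eigenVec (Umat A u q.1 q.2)) - deriv (u q.1) q.2
    = ψ q.1 q.2 (u q.1 q.2) (sgrad (fun y => u y q.2) q.1)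

/-- (A2): `−ψ` and `ξᵀAξ` are concave in `p`. -/
def A2cond {n : ℕ} (A : (Fin n → ℝ) → ℝ → (Fin n → ℝ) → Mat n)
    (ψ : (Fin n → ℝ) → ℝ → ℝ → (Fin n → ℝ) → ℝ) : Prop :=
  (∀ x t z, ConcaveOn ℝ Set.univ fun p : Fin n → ℝ => -(ψ x t z p)) ∧
    ∀ x t (ξ : Fin n → ℝ), ConcaveOn ℝ Set.univ fun p => qform (A x t p) ξ

/-- (A4): `ψ_z ≤ 0`. -/
def A4cond {n : ℕ} (ψ : (Fin n → ℝ) → ℝ → ℝ → (Fin n → ℝ) → ℝ) : Prop :=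
  ∀ x t z p, deriv (fun w => ψ x t w p) z ≤ 0

/-- (sub): `u̲` is an admissible strict subsolution with gap `δ₀` on `Q`. -/
def Subsol {n : ℕ} (Γ : Set (Fin n → ℝ)) (f : (Fin n → ℝ) → ℝ)
    (A : (Fin n → ℝ) → ℝ → (Fin n → ℝ) → Mat n)
    (ψ : (Fin n → ℝ) → ℝ → ℝ → (Fin n → ℝ) → ℝ) (δ₀ : ℝ)
    (ub : (Fin n → ℝ) → ℝ → ℝ) (Q : Set ((Fin n → ℝ) × ℝ)) : Prop :=
  Admissible Γ A ub Q ∧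
    ∀ q ∈ Q, f (eigenVec (Umat A ub q.1 q.2)) - deriv (ub q.1) q.2
      ≥ ψ q.1 q.2 (ub q.1 q.2) (sgrad (fun y => ub y q.2) q.1) + δ₀

/-- `F(h) := f(λ(h))` (extended to all of matrix space by symmetrizing `h`). -/
def Ffunc {n : ℕ} (f : (Fin n → ℝ) → ℝ) (h : Fin n → Fin n → ℝ) : ℝ :=
  f (eigenVec (Matrix.of fun i j => (h i j + h j i) / 2))

/-- `F^{ij} = ∂F/∂h_{ij}`, evaluated at the matrix `U`. -/
def Fmat {n : ℕ} (f : (Fin n → ℝ) → ℝ) (U : Mat n) : Mat n :=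
  Matrix.of fun i j =>
    fderiv ℝ (Ffunc f) (fun a b => U a b) (Pi.single i (Pi.single j 1))

/-- The linearized operator
`𝓛v = Σ F^{ij} ∂²v/∂x_i∂x_j + Σ_k (Σ F^{ij} ∂A^{ij}/∂p_k − ψ_{p_k}) ∂v/∂x_k − ∂ₜv`,
where the coefficients are evaluated at `u`. -/
def Lop {n : ℕ} (f : (Fin n → ℝ) → ℝ)
    (A : (Fin n → ℝ) → ℝ → (Fin n → ℝ) → Mat n)
    (ψ : (Fin n → ℝ) → ℝ → ℝ → (Fin n → ℝ) → ℝ)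
    (u v : (Fin n → ℝ) → ℝ → ℝ) (x : Fin n → ℝ) (t : ℝ) : ℝ :=
  (∑ i, ∑ j, Fmat f (Umat A u x t) i j * shess (fun y => v y t) x i j)
    + (∑ k, ((∑ i, ∑ j, Fmat f (Umat A u x t) i j *
          fderiv ℝ (fun p => A x t p i j) (sgrad (fun y => u y t) x) (Pi.single k 1))
        - fderiv ℝ (fun p => ψ x t (u x t) p) (sgrad (fun y => u y t) x) (Pi.single k 1))
        * sgrad (fun y => v y t) x k)
    - deriv (v x) t

/-- Pointwise bound for the `C¹_x` norm `|u| + |Du|` on `Q`. -/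
def C1xBound {n : ℕ} (u : (Fin n → ℝ) → ℝ → ℝ) (Q : Set ((Fin n → ℝ) × ℝ)) (K : ℝ) : Prop :=
  ∀ q ∈ Q, |u q.1 q.2| + ‖sgrad (fun y => u y q.2) q.1‖ ≤ K

/-- Pointwise bound for the `C²` norm `|v| + |Dv| + |D²v| + |∂ₜv|` on `Q`. -/
def C2Bound {n : ℕ} (v : (Fin n → ℝ) → ℝ → ℝ) (Q : Set ((Fin n → ℝ) × ℝ)) (K : ℝ) : Prop :=
  ∀ q ∈ Q, |v q.1 q.2| + ‖sgrad (fun y => v y q.2) q.1‖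
    + matNorm (shess (fun y => v y q.2) q.1) + |deriv (v q.1) q.2| ≤ K

/-- Bound `K` for all derivatives of `φ` of order ≤ `k₀` on `Q`. -/
def CkBound {n : ℕ} (k₀ : ℕ) (φ : (Fin n → ℝ) → ℝ → ℝ)
    (Q : Set ((Fin n → ℝ) × ℝ)) (K : ℝ) : Prop :=
  ∀ q ∈ Q, ∀ k : ℕ, k ≤ k₀ →
    ‖iteratedFDeriv ℝ k (fun p : (Fin n → ℝ) × ℝ => φ p.1 p.2) q‖ ≤ K

/-- First half of (A1): `p·∇_x(ξᵀAξ) ≤ ψ̄₁(x,t)|ξ|²(1+|p|^{γ₁})`. -/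
def A1a {n : ℕ} (A : (Fin n → ℝ) → ℝ → (Fin n → ℝ) → Mat n)
    (ψb1 : (Fin n → ℝ) → ℝ → ℝ) (γ₁ : ℝ) (Ω : Set (Fin n → ℝ)) (T : ℝ) : Prop :=
  ∀ x ∈ closure Ω, ∀ t ∈ Set.Icc (0 : ℝ) T, ∀ p ξ : Fin n → ℝ,
    fderiv ℝ (fun y => qform (A y t p) ξ) x p ≤ ψb1 x t * ‖ξ‖ ^ 2 * (1 + ‖p‖ ^ γ₁)

/-- Second half of (A1): `p·∇_xψ + |p|²ψ_z ≥ −ψ̄₂(x,t,z)(1+|p|^{γ₂})`. -/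
def A1b {n : ℕ} (ψ : (Fin n → ℝ) → ℝ → ℝ → (Fin n → ℝ) → ℝ)
    (ψb2 : (Fin n → ℝ) → ℝ → ℝ → ℝ) (γ₂ : ℝ) (Ω : Set (Fin n → ℝ)) (T : ℝ) : Prop :=
  ∀ x ∈ closure Ω, ∀ t ∈ Set.Icc (0 : ℝ) T, ∀ z : ℝ, ∀ p : Fin n → ℝ,
    fderiv ℝ (fun y => ψ y t z p) x p + ‖p‖ ^ 2 * deriv (fun w => ψ x t w p) z
      ≥ -(ψb2 x t z * (1 + ‖p‖ ^ γ₂))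

/-- (A3): strict concavity of `p ↦ ξᵀA(x,t,p)ξ`. -/
def A3cond {n : ℕ} (A : (Fin n → ℝ) → ℝ → (Fin n → ℝ) → Mat n) (c₀ : ℝ) : Prop :=
  ∀ x t (p ξ η : Fin n → ℝ),
    fderiv ℝ (fun q => fderiv ℝ (fun r => qform (A x t r) ξ) q η) p η
      ≤ -c₀ * ‖ξ‖ ^ 2 * ‖η‖ ^ 2 + c₀ * (∑ i, ξ i * η i) ^ 2


theorem zero_notMem_of_goodCone {n : ℕ} {Γ : Set (Fin n → ℝ)} (hΓ : GoodCone Γ) :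
    (0 : Fin n → ℝ) ∉ Γ := by
  obtain ⟨ho, -, hcone, -, -, hne⟩ := hΓ
  intro h0
  apply hne
  ext x
  simp only [Set.mem_univ, iff_true]
  have hlim : Filter.Tendsto (fun s : ℝ => s • x) (𝓝[>] 0) (𝓝 0) := by
    have : Filter.Tendsto (fun s : ℝ => s • x) (𝓝 0) (𝓝 ((0 : ℝ) • x)) :=
      (continuous_id.smul continuous_const).tendsto 0
    rw [zero_smul] at this
    exact this.mono_left nhdsWithin_le_nhds
  obtain ⟨s, hs, hs0⟩ :=
    ((hlim.eventually (ho.mem_nhds h0)).and self_mem_nhdsWithin).exists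
  have hs0 : 0 < s := hs0
  have := hcone _ hs s⁻¹ (inv_pos.mpr hs0)
  rwa [smul_smul, inv_mul_cancel₀ hs0.ne', one_smul] at this

theorem sum_pos_of_mem_goodCone {n : ℕ} {Γ : Set (Fin n → ℝ)}
    (hΓ : GoodCone Γ) {lam : Fin n → ℝ} (hlam : lam ∈ Γ) : 0 < ∑ i, lam i := by
  have h0 := zero_notMem_of_goodCone hΓ
  obtain ⟨-, hconv, hcone, hsymm, hpos, -⟩ := hΓ
  by_contra! hle
  have hsum : ∑ σ : Equiv.Perm (Fin n), lam ∘ σ ∈ Γ := by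
    have hcard : (0 : ℝ) < Fintype.card (Equiv.Perm (Fin n)) := by
      exact_mod_cast Fintype.card_pos
    have hmem : ∑ σ : Equiv.Perm (Fin n),
        (Fintype.card (Equiv.Perm (Fin n)) : ℝ)⁻¹ • (lam ∘ σ) ∈ Γ :=
      hconv.sum_mem (fun _ _ => (inv_pos.mpr hcard).le)
        (by simp [Finset.sum_const])
        (fun σ _ => hsymm σ lam hlam)
    rw [← Finset.smul_sum] at hmem
    have := hcone _ hmem _ hcard
    rwa [smul_smul, mul_inv_cancel₀ hcard.ne', one_smul] at this
  have hconst : ∀ i j, (∑ σ : Equiv.Perm (Fin n), lam ∘ σ) i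
      = (∑ σ : Equiv.Perm (Fin n), lam ∘ σ) j := by
    intro i j
    simp only [Finset.sum_apply, Function.comp]
    exact Fintype.sum_equiv (Equiv.mulRight (Equiv.swap i j)) _ _ (by simp)
  set v := ∑ σ : Equiv.Perm (Fin n), lam ∘ σ with hv
  have htot : ∑ i, v i ≤ 0 := by
    simp only [hv, Finset.sum_apply, Function.comp]
    rw [Finset.sum_comm]
    refine Finset.sum_nonpos fun σ _ => ?_
    rw [Equiv.sum_comp σ lam]
    exact hle
  have hv0 : ∀ i, v i ≤ 0 := by
    intro i
    by_contra! hi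
    have : 0 < ∑ j, v j := Finset.sum_pos (fun j _ => by rw [hconst j i]; exact hi) ⟨i, by simp⟩
    linarith
  by_cases hz : v = 0
  · exact h0 (hz ▸ hsum)
  · have hneg : ∀ i, v i < 0 := by
      intro i
      refine lt_of_le_of_ne (hv0 i) fun hi => hz ?_
      funext j
      rw [hconst j i, hi, Pi.zero_apply]
    have hmem : -v ∈ Γ := hpos fun i => by simpa using hneg i
    have := hconv hsum hmem (by norm_num : (0 : ℝ) ≤ 1 / 2) (by norm_num : (0 : ℝ) ≤ 1 / 2)
      (by norm_num)
    rw [smul_neg, add_neg_cancel] at this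
    exact h0 this

/-- Spatial Laplacian. -/
def slap {n : ℕ} (v : (Fin n → ℝ) → ℝ) (x : Fin n → ℝ) : ℝ := ∑ i, shess v x i i

theorem slap_add_trace_pos {n : ℕ} {Γ : Set (Fin n → ℝ)}
    (hΓ : GoodCone Γ) {A : (Fin n → ℝ) → ℝ → (Fin n → ℝ) → Mat n}
    {u : (Fin n → ℝ) → ℝ → ℝ} {x : Fin n → ℝ} {t : ℝ}
    (h : eigenVec (Umat A u x t) ∈ Γ) :
    0 < slap (fun y => u y t) x + (A x t (sgrad (fun y => u y t) x)).trace := by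
  have hpos := sum_pos_of_mem_goodCone hΓ h
  have hH : (Umat A u x t).IsHermitian := by
    by_contra hH
    rw [eigenVec, dif_neg hH] at h
    exact zero_notMem_of_goodCone hΓ h
  rw [eigenVec, dif_pos hH] at hpos
  have htr := hH.trace_eq_sum_eigenvalues
  simp only [RCLike.ofReal_real_eq_id, id] at htr
  rw [← htr, Umat, Matrix.trace_add] at hpos
  exact hpos

theorem concaveOn_trace {n : ℕ} {B : (Fin n → ℝ) → Mat n}
    (h : ∀ ξ : Fin n → ℝ, ConcaveOn ℝ Set.univ fun p => qform (B p) ξ) :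
    ConcaveOn ℝ Set.univ fun p => (B p).trace := by
  have hq : ∀ (S : Mat n) i, qform S (Pi.single i 1) = S i i := by
    intro S i
    simp [qform, Pi.single_apply]
  refine ⟨convex_univ, fun p _ q _ a b ha hb hab => ?_⟩
  simp only [Matrix.trace, Matrix.diag_apply, Finset.smul_sum, ← Finset.sum_add_distrib]
  refine Finset.sum_le_sum fun i _ => ?_
  have := (h (Pi.single i 1)).2 (Set.mem_univ p) (Set.mem_univ q) ha hb hab
  simpa only [hq] using this

/-- A concave function bounded on the unit ball grows at most linearly from above. -/
theorem ConcaveOn.le_linear_growth {E : Type*} [NormedAddCommGroup E] [NormedSpace ℝ E]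
    {g : E → ℝ} (hg : ConcaveOn ℝ Set.univ g) {M : ℝ}
    (hM : ∀ p : E, ‖p‖ ≤ 1 → |g p| ≤ M) (p : E) : g p ≤ 2 * M * (1 + ‖p‖) := by
  have hM0 : 0 ≤ M := (abs_nonneg _).trans (hM 0 (by simp))
  rcases le_total ‖p‖ 1 with hp | hp
  · nlinarith [le_abs_self (g p), hM p hp, norm_nonneg p]
  · have hp0 : 0 < ‖p‖ := by linarith
    have h1 := hg.2 (Set.mem_univ p) (Set.mem_univ (0 : E)) (inv_nonneg.mpr hp0.le)
      (sub_nonneg.mpr (inv_le_one_of_one_le₀ hp)) (by ring)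
    rw [smul_zero, add_zero] at h1
    have h2 := (abs_le.mp (hM (‖p‖⁻¹ • p)
      (by rw [norm_smul, norm_inv, norm_norm, inv_mul_cancel₀ hp0.ne']))).2
    have h3 := (abs_le.mp (hM 0 (by simp))).1
    simp only [smul_eq_mul] at h1
    have h4 : ‖p‖ * (‖p‖⁻¹ * g p + (1 - ‖p‖⁻¹) * g 0) ≤ ‖p‖ * M :=
      mul_le_mul_of_nonneg_left (h1.trans h2) hp0.le
    have h5 : ‖p‖ * (‖p‖⁻¹ * g p + (1 - ‖p‖⁻¹) * g 0) = g p + (‖p‖ - 1) * g 0 := by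
      field_simp
    nlinarith

theorem deriv2_nonpos_of_isLocalMax {g g' : ℝ → ℝ} {a c : ℝ} (hg : ∀ s, HasDerivAt g (g' s) s)
    (hg' : HasDerivAt g' c a) (hmax : IsLocalMax g a) : c ≤ 0 := by
  by_contra! hc
  have hderiv : deriv g = g' := funext fun s => (hg s).deriv
  have hmin : IsLocalMin g a :=
    isLocalMin_of_deriv_deriv_pos (by rw [hderiv, hg'.deriv]; exact hc)
      hmax.deriv_eq_zero (hg a).continuousAt
  have hconst : g =ᶠ[𝓝 a] fun _ => g a := by
    filter_upwards [hmax, hmin] with s h1 h2 using le_antisymm h1 h2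
  have h0 : deriv g =ᶠ[𝓝 a] fun _ => 0 := by
    filter_upwards [hconst.eventually_nhds] with s hs
    rw [Filter.EventuallyEq.deriv_eq hs, deriv_const]
  have := h0.deriv_eq
  rw [hderiv, hg'.deriv, deriv_const] at this
  exact hc.ne' this

theorem differentiable_partial {n : ℕ} {v : (Fin n → ℝ) → ℝ} (hv : ContDiff ℝ 2 v)
    (e : Fin n → ℝ) : Differentiable ℝ fun y => fderiv ℝ v y e :=
  ((hv.fderiv_right (m := 1) (by norm_num)).differentiable (by norm_num)).clm_apply
    (differentiable_const e)

theorem shess_diag_nonpos_of_isLocalMax {n : ℕ} {v : (Fin n → ℝ) → ℝ} (hv : ContDiff ℝ 2 v)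
    {x : Fin n → ℝ} (hx : IsLocalMax v x) (i : Fin n) : shess v x i i ≤ 0 := by
  set e : Fin n → ℝ := Pi.single i 1
  have hline : ∀ s : ℝ, HasDerivAt (fun s : ℝ => x + s • e) e s := fun s => by
    simpa using ((hasDerivAt_id s).smul_const e).const_add x
  have hx0 : x + (0 : ℝ) • e = x := by simp
  refine deriv2_nonpos_of_isLocalMax (g := fun s : ℝ => v (x + s • e))
    (g' := fun s : ℝ => fderiv ℝ v (x + s • e) e) (a := 0) (fun s => ?_) ?_ ?_
  · exact ((hv.differentiable (by norm_num)) _).hasFDerivAt.comp_hasDerivAt s (hline s)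
  · have h := (differentiable_partial hv e (x + (0 : ℝ) • e)).hasFDerivAt.comp_hasDerivAt 0
      (hline 0)
    rw [hx0] at h
    exact h
  · have hc : ContinuousAt (fun s : ℝ => x + s • e) 0 := (hline 0).continuousAt
    have hx' : IsLocalMax v (x + (0 : ℝ) • e) := by rwa [hx0]
    exact hc.eventually hx'

theorem sgrad_sub {n : ℕ} {v w : (Fin n → ℝ) → ℝ} (hv : Differentiable ℝ v)
    (hw : Differentiable ℝ w) (x : Fin n → ℝ) :
    sgrad (fun y => v y - w y) x = sgrad v x - sgrad w x := by
  funext i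
  simp [sgrad, fderiv_fun_sub (hv x) (hw x)]

theorem slap_sub {n : ℕ} {v w : (Fin n → ℝ) → ℝ} (hv : ContDiff ℝ 2 v)
    (hw : ContDiff ℝ 2 w) (x : Fin n → ℝ) :
    slap (fun y => v y - w y) x = slap v x - slap w x := by
  rw [slap, slap, slap, ← Finset.sum_sub_distrib]
  refine Finset.sum_congr rfl fun i _ => ?_
  have h : (fun y => fderiv ℝ (fun z => v z - w z) y (Pi.single i 1))
      = fun y => fderiv ℝ v y (Pi.single i 1) - fderiv ℝ w y (Pi.single i 1) := by
    funext y
    rw [fderiv_fun_sub (hv.differentiable (by norm_num) y) (hw.differentiable (by norm_num) y)]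
    rfl
  simp only [shess, Matrix.of_apply]
  rw [h, fderiv_fun_sub (differentiable_partial hv _ x) (differentiable_partial hw _ x)]
  rfl

/-- Comparison with a strict upper barrier for a quasilinear operator `Δv + g(x, Dv)`. -/
theorem le_of_supersolution {n : ℕ} {v h : (Fin n → ℝ) → ℝ} (hv : ContDiff ℝ 2 v)
    (hh : ContDiff ℝ 2 h) {D : Set (Fin n → ℝ)} (hDo : IsOpen D) (hDb : Bornology.IsBounded D)
    {g : (Fin n → ℝ) → (Fin n → ℝ) → ℝ}
    (hsub : ∀ x ∈ D, 0 < slap v x + g x (sgrad v x))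
    (hsup : ∀ x ∈ D, slap h x + g x (sgrad h x) ≤ 0)
    (hbd : ∀ x ∈ frontier D, v x ≤ h x) : ∀ x ∈ closure D, v x ≤ h x := by
  intro x hx
  have hw : ContDiff ℝ 2 fun y => v y - h y := hv.sub hh
  obtain ⟨x₀, hx₀, hmax⟩ :=
    hDb.isCompact_closure.exists_isMaxOn ⟨x, hx⟩ hw.continuous.continuousOn
  have hxx₀ : v x - h x ≤ v x₀ - h x₀ := hmax hx
  by_cases hxD : x₀ ∈ D
  · exfalso
    have hloc : IsLocalMax (fun y => v y - h y) x₀ :=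
      (hmax.on_subset subset_closure).isLocalMax (hDo.mem_nhds hxD)
    have hgrad : sgrad v x₀ = sgrad h x₀ := by
      rw [← sub_eq_zero, ← sgrad_sub (hv.differentiable (by norm_num))
        (hh.differentiable (by norm_num))]
      funext i
      simp [sgrad, hloc.fderiv_eq_zero]
    have hlap : slap (fun y => v y - h y) x₀ ≤ 0 :=
      Finset.sum_nonpos fun i _ => shess_diag_nonpos_of_isLocalMax hw hloc i
    rw [slap_sub hv hh] at hlap
    have h1 := hsub x₀ hxD
    have h2 := hsup x₀ hxD
    rw [hgrad] at h1
    linarith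
  · have := hbd x₀ (by rw [hDo.frontier_eq]; exact ⟨hx₀, hxD⟩)
    linarith

theorem contDiff_expBarrier {n : ℕ} {φ ρ : (Fin n → ℝ) → ℝ} (hφ : ContDiff ℝ 2 φ)
    (hρ : ContDiff ℝ 2 ρ) (c K κ : ℝ) :
    ContDiff ℝ 2 fun y => φ y + c - K * Real.exp (κ * ρ y) := by
  fun_prop

theorem fderiv_expBarrier {n : ℕ} {φ ρ : (Fin n → ℝ) → ℝ} {x : Fin n → ℝ}
    (hφ : DifferentiableAt ℝ φ x) (hρ : DifferentiableAt ℝ ρ x) (c K κ : ℝ) (e : Fin n → ℝ) :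
    fderiv ℝ (fun y => φ y + c - K * Real.exp (κ * ρ y)) x e
      = fderiv ℝ φ x e - K * κ * Real.exp (κ * ρ x) * fderiv ℝ ρ x e := by
  have h := (hφ.hasFDerivAt.add_const c).sub
    (((hρ.hasFDerivAt.const_mul κ).exp).const_mul K)
  have h' : HasFDerivAt (fun y => φ y + c - K * Real.exp (κ * ρ y)) _ x := h
  rw [h'.fderiv]
  simp only [sub_apply, smul_apply, smul_eq_mul]
  ring

theorem slap_expBarrier {n : ℕ} {φ ρ : (Fin n → ℝ) → ℝ} (hφ : ContDiff ℝ 2 φ)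
    (hρ : ContDiff ℝ 2 ρ) (c K κ : ℝ) (x : Fin n → ℝ) :
    slap (fun y => φ y + c - K * Real.exp (κ * ρ y)) x
      = slap φ x - K * κ * Real.exp (κ * ρ x) *
          (κ * ∑ i, sgrad ρ x i ^ 2 + slap ρ x) := by
  have hφd : Differentiable ℝ φ := hφ.differentiable (by norm_num)
  have hρd : Differentiable ℝ ρ := hρ.differentiable (by norm_num)
  simp only [slap]
  rw [Finset.mul_sum, ← Finset.sum_add_distrib, Finset.mul_sum, ← Finset.sum_sub_distrib]
  refine Finset.sum_congr rfl fun i _ => ?_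
  simp only [shess, Matrix.of_apply, sgrad]
  have h : (fun y => fderiv ℝ (fun y => φ y + c - K * Real.exp (κ * ρ y)) y (Pi.single i 1))
      = fun y => fderiv ℝ φ y (Pi.single i 1)
        - K * κ * Real.exp (κ * ρ y) * fderiv ℝ ρ y (Pi.single i 1) :=
    funext fun y => fderiv_expBarrier (hφd y) (hρd y) c K κ _
  rw [h]
  have h2 := (differentiable_partial hφ (Pi.single i 1) x).hasFDerivAt.sub
    (((((hρd x).hasFDerivAt.const_mul κ).exp).const_mul (K * κ)).mul
      (differentiable_partial hρ (Pi.single i 1) x).hasFDerivAt)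
  have h3 : HasFDerivAt (fun y => fderiv ℝ φ y (Pi.single i 1)
      - K * κ * Real.exp (κ * ρ y) * fderiv ℝ ρ y (Pi.single i 1)) _ x := h2
  rw [h3.fderiv]
  simp only [sub_apply, smul_apply,
    add_apply, smul_eq_mul]
  ring

/-- Exponential barriers `φ + c - K exp(κρ)`, with constants uniform in the data, for operators
`Δv + g(x, Dv)` whose lower order part has linear growth. -/
theorem exists_expBarrier {n : ℕ} {C₁ M c₀ R : ℝ} (hC₁ : 0 ≤ C₁) (hM : 0 ≤ M) (hc₀ : 0 < c₀) :
    ∃ κ > 0, ∃ K₀ > 0, ∀ K ≥ K₀, ∀ (v φ ρ : (Fin n → ℝ) → ℝ) (c : ℝ) (D : Set (Fin n → ℝ))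
      (g : (Fin n → ℝ) → (Fin n → ℝ) → ℝ),
      ContDiff ℝ 2 v → ContDiff ℝ 2 φ → ContDiff ℝ 2 ρ → IsOpen D → Bornology.IsBounded D →
      (∀ x ∈ D, ∀ p, g x p ≤ C₁ * (1 + ‖p‖)) →
      (∀ x ∈ D, slap φ x ≤ M ∧ ‖sgrad φ x‖ ≤ M) →
      (∀ x ∈ D, -M ≤ slap ρ x ∧ ‖sgrad ρ x‖ ≤ M) →
      (∀ x ∈ D, c₀ ≤ ∑ i, sgrad ρ x i ^ 2) → (∀ x ∈ D, -R ≤ ρ x) →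
      (∀ x ∈ D, 0 < slap v x + g x (sgrad v x)) →
      (∀ x ∈ frontier D, v x ≤ φ x + c - K * Real.exp (κ * ρ x)) →
      ∀ x ∈ closure D, v x ≤ φ x + c - K * Real.exp (κ * ρ x) := by
  set κ : ℝ := (1 + M + C₁ * M) / c₀ with hκdef
  have hκ : 0 < κ := by positivity
  have hκc : κ * c₀ = 1 + M + C₁ * M := by rw [hκdef]; field_simp
  refine ⟨κ, hκ, (1 + M + C₁ + C₁ * M) / (κ * Real.exp (-(κ * R))), by positivity, ?_⟩
  intro K hK v φ ρ c D g hv hφ hρ hDo hDb hg hφM hρM hρc hρR hsub hbd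
  rw [ge_iff_le, div_le_iff₀ (by positivity)] at hK
  have hK0 : 0 ≤ K := by
    by_contra! hneg
    have : K * (κ * Real.exp (-(κ * R))) ≤ 0 :=
      mul_nonpos_of_nonpos_of_nonneg hneg.le (by positivity)
    have : 0 ≤ C₁ * M := by positivity
    linarith
  refine le_of_supersolution hv (contDiff_expBarrier hφ hρ c K κ) hDo hDb hsub ?_ hbd
  intro x hx
  have hexp : Real.exp (-(κ * R)) ≤ Real.exp (κ * ρ x) :=
    Real.exp_le_exp.mpr (by nlinarith [hρR x hx])
  set P : ℝ := K * κ * Real.exp (κ * ρ x) with hP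
  have hP0 : 0 ≤ P := by positivity
  have hPge : 1 + M + C₁ + C₁ * M ≤ P := by
    refine hK.trans ?_
    rw [hP, mul_assoc]
    gcongr
  have hnorm : ‖sgrad (fun y => φ y + c - K * Real.exp (κ * ρ y)) x‖ ≤ M + P * M := by
    have : sgrad (fun y => φ y + c - K * Real.exp (κ * ρ y)) x
        = sgrad φ x - P • sgrad ρ x := by
      funext i
      exact fderiv_expBarrier (hφ.differentiable (by norm_num) x)
        (hρ.differentiable (by norm_num) x) c K κ _
    rw [this]
    refine (norm_sub_le _ _).trans (add_le_add (hφM x hx).2 ?_)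
    rw [norm_smul, Real.norm_of_nonneg hP0]
    exact mul_le_mul_of_nonneg_left (hρM x hx).2 hP0
  rw [slap_expBarrier hφ hρ, ← hP]
  have h1 := (hg x hx _).trans
    (mul_le_mul_of_nonneg_left (add_le_add_right hnorm 1) hC₁)
  have h2 : 1 + C₁ * M ≤ κ * ∑ i, sgrad ρ x i ^ 2 + slap ρ x := by
    have := mul_le_mul_of_nonneg_left (hρc x hx) hκ.le
    linarith [(hρM x hx).1]
  have h3 := mul_le_mul_of_nonneg_left h2 hP0
  nlinarith [(hφM x hx).1]

/-- One-sided derivative test at a boundary point of a sublevel set. -/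
theorem fderiv_nonneg_of_nonneg_on_sublevel {E : Type*} [NormedAddCommGroup E] [NormedSpace ℝ E]
    {ρ w : E → ℝ} {x e : E} {ε : ℝ} (hρ : DifferentiableAt ℝ ρ x) (hw : DifferentiableAt ℝ w x)
    (hε : 0 < ε) (hρx : ρ x = 0) (hdρ : fderiv ℝ ρ x ≠ 0) (hwx : w x = 0)
    (hnn : ∀ y, ρ y < 0 → -ε < ρ y → 0 ≤ w y) (he : fderiv ℝ ρ x e ≤ 0) :
    0 ≤ fderiv ℝ w x e := by
  have hstrict : ∀ e : E, fderiv ℝ ρ x e < 0 → 0 ≤ fderiv ℝ w x e := by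
    intro e he
    have hline : HasDerivAt (fun s : ℝ => x + s • e) e 0 := by
      simpa using ((hasDerivAt_id (0 : ℝ)).smul_const e).const_add x
    have hx0 : x + (0 : ℝ) • e = x := by simp
    have hslope : ∀ h : E → ℝ, DifferentiableAt ℝ h x → h x = 0 →
        Filter.Tendsto (fun s : ℝ => s⁻¹ * h (x + s • e)) (𝓝[>] 0) (𝓝 (fderiv ℝ h x e)) := by
      intro h hd hx
      have hd' : HasFDerivAt h (fderiv ℝ h x) (x + (0 : ℝ) • e) := by
        rw [hx0]; exact hd.hasFDerivAt
      have := (hd'.comp_hasDerivAt 0 hline).tendsto_slope_zero_right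
      simpa [hx] using this
    have h1 : ∀ᶠ s in 𝓝[>] (0 : ℝ), -ε < ρ (x + s • e) := by
      have hc : ContinuousAt (fun s : ℝ => ρ (x + s • e)) 0 :=
        ContinuousAt.comp (g := ρ) (by rw [hx0]; exact hρ.continuousAt) hline.continuousAt
      refine nhdsWithin_le_nhds (hc.eventually (lt_mem_nhds ?_))
      simpa only [hx0, hρx, neg_lt_zero] using hε
    refine ge_of_tendsto (hslope w hw hwx) ?_
    filter_upwards [h1, (hslope ρ hρ hρx).eventually (gt_mem_nhds he), self_mem_nhdsWithin]
      with s hs1 hs2 hs0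
    have hs0 : 0 < s := hs0
    have hlt : ρ (x + s • e) < 0 := by
      by_contra! hge
      exact absurd hs2 (not_lt.mpr (by positivity))
    exact mul_nonneg (inv_nonneg.mpr hs0.le) (hnn _ hlt hs1)
  obtain ⟨ν, hν⟩ : ∃ ν, fderiv ℝ ρ x ν < 0 := by
    obtain ⟨ν, hν⟩ : ∃ ν, fderiv ℝ ρ x ν ≠ 0 := by
      by_contra! h
      exact hdρ (ContinuousLinearMap.ext h)
    rcases hν.lt_or_gt with h | h
    · exact ⟨ν, h⟩
    · exact ⟨-ν, by simpa using h⟩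
  have hlim : Filter.Tendsto (fun s : ℝ => fderiv ℝ w x (e + s • ν)) (𝓝[>] 0)
      (𝓝 (fderiv ℝ w x e)) := by
    have hc : Continuous fun s : ℝ => fderiv ℝ w x (e + s • ν) := by fun_prop
    have := hc.tendsto 0
    rw [zero_smul, add_zero] at this
    exact this.mono_left nhdsWithin_le_nhds
  refine ge_of_tendsto hlim ?_
  filter_upwards [self_mem_nhdsWithin] with s hs
  have hs : 0 < s := hs
  refine hstrict _ ?_
  rw [map_add, map_smul, smul_eq_mul]
  nlinarith

theorem norm_sgrad_le_of_squeeze {n : ℕ} {ρ v lo hi : (Fin n → ℝ) → ℝ} {x : Fin n → ℝ} {ε M : ℝ}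
    (hρ : DifferentiableAt ℝ ρ x) (hv : DifferentiableAt ℝ v x) (hlo : DifferentiableAt ℝ lo x)
    (hhi : DifferentiableAt ℝ hi x) (hε : 0 < ε) (hρx : ρ x = 0) (hdρ : fderiv ℝ ρ x ≠ 0)
    (hlox : lo x = v x) (hhix : hi x = v x)
    (hsq : ∀ y, ρ y < 0 → -ε < ρ y → lo y ≤ v y ∧ v y ≤ hi y)
    (hloM : ‖sgrad lo x‖ ≤ M) (hhiM : ‖sgrad hi x‖ ≤ M) : ‖sgrad v x‖ ≤ M := by
  have key : ∀ e, fderiv ℝ ρ x e ≤ 0 →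
      fderiv ℝ lo x e ≤ fderiv ℝ v x e ∧ fderiv ℝ v x e ≤ fderiv ℝ hi x e := by
    intro e he
    have h1 := fderiv_nonneg_of_nonneg_on_sublevel (w := fun y => v y - lo y) hρ (hv.sub hlo) hε
      hρx hdρ (by simp [hlox]) (fun y h1 h2 => sub_nonneg.mpr (hsq y h1 h2).1) he
    have h2 := fderiv_nonneg_of_nonneg_on_sublevel (w := fun y => hi y - v y) hρ (hhi.sub hv) hε
      hρx hdρ (by simp [hhix]) (fun y h1 h2 => sub_nonneg.mpr (hsq y h1 h2).2) he
    rw [fderiv_fun_sub hv hlo, sub_apply] at h1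
    rw [fderiv_fun_sub hhi hv, sub_apply] at h2
    constructor <;> linarith
  refine (pi_norm_le_iff_of_nonneg ((norm_nonneg _).trans hloM)).mpr fun i => ?_
  have hl := abs_le.mp ((norm_le_pi_norm _ i).trans hloM)
  have hh := abs_le.mp ((norm_le_pi_norm _ i).trans hhiM)
  simp only [sgrad] at hl hh ⊢
  rw [Real.norm_eq_abs, abs_le]
  rcases le_total (fderiv ℝ ρ x (Pi.single i 1)) 0 with h | h
  · obtain ⟨h1, h2⟩ := key _ h
    constructor <;> linarith
  · obtain ⟨h1, h2⟩ := key (-Pi.single i 1) (by simpa using h)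
    simp only [map_neg] at h1 h2
    constructor <;> linarith

theorem fderiv_slice {n : ℕ} {u : (Fin n → ℝ) → ℝ → ℝ}
    (hu : Differentiable ℝ fun q : (Fin n → ℝ) × ℝ => u q.1 q.2)
    (x : Fin n → ℝ) (t : ℝ) (e : Fin n → ℝ) :
    fderiv ℝ (fun y => u y t) x e
      = fderiv ℝ (fun q : (Fin n → ℝ) × ℝ => u q.1 q.2) (x, t) (e, 0) := by
  have h := (hu (x, t)).hasFDerivAt.comp x
    ((hasFDerivAt_id (𝕜 := ℝ) x).prodMk (hasFDerivAt_const t x))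
  have h' : HasFDerivAt (fun y => u y t) _ x := h
  rw [h'.fderiv]
  simp

theorem contDiff_slice {n : ℕ} {u : (Fin n → ℝ) → ℝ → ℝ} {k : WithTop ℕ∞}
    (hu : ContDiff ℝ k fun q : (Fin n → ℝ) × ℝ => u q.1 q.2) (t : ℝ) :
    ContDiff ℝ k fun y => u y t :=
  hu.comp (contDiff_id.prodMk contDiff_const)

theorem contDiff_partial_slice {n : ℕ} {u : (Fin n → ℝ) → ℝ → ℝ} {k : WithTop ℕ∞}
    (hu : ContDiff ℝ (k + 1) fun q : (Fin n → ℝ) × ℝ => u q.1 q.2) (e : Fin n → ℝ) :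
    ContDiff ℝ k fun q : (Fin n → ℝ) × ℝ => fderiv ℝ (fun y => u y q.2) q.1 e := by
  have hd : Differentiable ℝ fun q : (Fin n → ℝ) × ℝ => u q.1 q.2 :=
    hu.differentiable (by simp)
  simp only [fderiv_slice hd]
  exact (hu.fderiv_right le_rfl).clm_apply contDiff_const

theorem continuous_sgrad_slice {n : ℕ} {u : (Fin n → ℝ) → ℝ → ℝ}
    (hu : ContDiff ℝ 2 fun q : (Fin n → ℝ) × ℝ => u q.1 q.2) :
    Continuous fun q : (Fin n → ℝ) × ℝ => sgrad (fun y => u y q.2) q.1 :=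
  continuous_pi fun i =>
    (contDiff_partial_slice (k := 1) (by norm_num; exact hu) (Pi.single i 1)).continuous

theorem continuous_slap_slice {n : ℕ} {u : (Fin n → ℝ) → ℝ → ℝ}
    (hu : ContDiff ℝ 2 fun q : (Fin n → ℝ) × ℝ => u q.1 q.2) :
    Continuous fun q : (Fin n → ℝ) × ℝ => slap (fun y => u y q.2) q.1 := by
  refine continuous_finsetSum _ fun i _ => ?_
  have h1 := contDiff_partial_slice (k := 1) (by norm_num; exact hu) (Pi.single i 1)
  exact (contDiff_partial_slice (k := 0)
    (u := fun y t => fderiv ℝ (fun z => u z t) y (Pi.single i 1)) (by simpa using h1)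
    (Pi.single i 1)).continuous

/-- estimate (1.11) of the paper, flat case: maximum-principle
bound `max_{Q̄_T}|u| + max_{𝒫Q_T}|Du| ≤ C`. -/
theorem statement3
    {n : ℕ} (hn : 2 ≤ n)
    (Ω : Set (Fin n → ℝ)) (hΩo : IsOpen Ω) (hΩb : Bornology.IsBounded Ω)
    (hΩs : SmoothBoundary Ω)
    (T : ℝ) (hT : 0 < T)
    (Γ : Set (Fin n → ℝ)) (hΓ : GoodCone Γ)
    (f : (Fin n → ℝ) → ℝ) (hfs : SmoothSymF Γ f) (hf1 : F1cond Γ f) (hf2 : F2cond Γ f)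
    (hf5 : F5cond Γ f)
    (A : (Fin n → ℝ) → ℝ → (Fin n → ℝ) → Mat n) (hA : ASmooth A)
    (ψ : (Fin n → ℝ) → ℝ → ℝ → (Fin n → ℝ) → ℝ) (hψ : PsiSmooth ψ)
    (hA2 : A2cond A ψ) (hA4 : A4cond ψ)
    (φ : (Fin n → ℝ) → ℝ → ℝ) (hφreg : RegInf φ)
    (δ₀ : ℝ) (hδ₀ : 0 < δ₀)
    (ub : (Fin n → ℝ) → ℝ → ℝ) (hubreg : RegN 2 ub)
    (hsub : Subsol Γ f A ψ δ₀ ub (QTbar Ω T))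
    (hubφ : ∀ x ∈ frontier Ω, ∀ t ∈ Set.Icc (0 : ℝ) T, ub x t = φ x t) :
    ∃ C > 0, ∀ u : (Fin n → ℝ) → ℝ → ℝ,
      RegN 2 u → Admissible Γ A u (QTbar Ω T) → SolvesE f A ψ u (QT Ω T) →
      (∀ q ∈ PQ Ω T, u q.1 q.2 = φ q.1 q.2) →
      (∀ q ∈ QTbar Ω T, ub q.1 q.2 ≤ u q.1 q.2) →
      (∀ q ∈ QTbar Ω T, |u q.1 q.2| ≤ C) ∧
        (∀ q ∈ PQ Ω T, ‖sgrad (fun y => u y q.2) q.1‖ ≤ C) := by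
  obtain ⟨ρ, hρs, hΩρ, hdρ⟩ := hΩs
  have hφ2 : ContDiff ℝ 2 fun q : (Fin n → ℝ) × ℝ => φ q.1 q.2 :=
    ContDiff.of_le hφreg (WithTop.coe_le_coe.mpr le_top)
  have hub2 : ContDiff ℝ 2 fun q : (Fin n → ℝ) × ℝ => ub q.1 q.2 := hubreg
  have hρ2 : ContDiff ℝ 2 ρ := hρs.of_le (WithTop.coe_le_coe.mpr le_top)
  have hρpair : ContDiff ℝ 2 fun q : (Fin n → ℝ) × ℝ => (fun y (_ : ℝ) => ρ y) q.1 q.2 :=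
    hρ2.comp contDiff_fst
  have hcl : IsCompact (closure Ω) := hΩb.isCompact_closure
  have hQ : IsCompact (QTbar Ω T) := hcl.prod isCompact_Icc
  have hρcl : ∀ x ∈ closure Ω, ρ x ≤ 0 := by
    refine fun x hx => closure_minimal (t := {x | ρ x ≤ 0}) ?_
      (isClosed_le hρ2.continuous continuous_const) hx
    rw [hΩρ]
    exact fun x (hx : ρ x < 0) => hx.le
  have hρfr : ∀ x ∈ frontier Ω, ρ x = 0 := by
    intro x hx
    rw [hΩo.frontier_eq] at hx
    refine le_antisymm (hρcl x hx.1) ?_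
    by_contra! h
    exact hx.2 (hΩρ ▸ h)
  -- Uniform bounds on the compact set `Q̄_T`.
  obtain ⟨Mφ, hMφ⟩ := hQ.exists_bound_of_continuousOn hφ2.continuous.continuousOn
  obtain ⟨Mub, hMub⟩ := hQ.exists_bound_of_continuousOn hub2.continuous.continuousOn
  obtain ⟨Gφ, hGφ⟩ := hQ.exists_bound_of_continuousOn (continuous_sgrad_slice hφ2).continuousOn
  obtain ⟨Gub, hGub⟩ := hQ.exists_bound_of_continuousOn (continuous_sgrad_slice hub2).continuousOn
  obtain ⟨Lφ, hLφ⟩ := hQ.exists_bound_of_continuousOn (continuous_slap_slice hφ2).continuousOn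
  obtain ⟨Gρ, hGρ⟩ := hQ.exists_bound_of_continuousOn (continuous_sgrad_slice (u := fun y _ => ρ y) hρpair).continuousOn
  obtain ⟨Lρ, hLρ⟩ := hQ.exists_bound_of_continuousOn (continuous_slap_slice (u := fun y _ => ρ y) hρpair).continuousOn
  have hAtr : Continuous fun q : ((Fin n → ℝ) × ℝ) × (Fin n → ℝ) => (A q.1.1 q.1.2 q.2).trace :=
    continuous_finsetSum _ fun i _ => (hA.2 i i).continuous
  obtain ⟨MA, hMA⟩ := (hQ.prod (isCompact_closedBall (0 : Fin n → ℝ) 1)).exists_bound_of_continuousOn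
    hAtr.continuousOn
  have hgrowth : ∀ x ∈ closure Ω, ∀ t ∈ Set.Icc 0 T, ∀ p,
      (A x t p).trace ≤ 2 * |MA| * (1 + ‖p‖) := by
    intro x hx t ht p
    refine ConcaveOn.le_linear_growth (concaveOn_trace (hA2.2 x t)) (fun p hp => ?_) p
    exact (hMA ((x, t), p) ⟨⟨hx, ht⟩, by simpa using hp⟩).trans (le_abs_self _)
  obtain ⟨R, hR⟩ := hcl.exists_bound_of_continuousOn (continuousOn_id (s := closure Ω))
  have hmem0 : ∀ x ∈ closure Ω, (x, (0 : ℝ)) ∈ QTbar Ω T := fun x hx => ⟨hx, le_rfl, hT.le⟩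
  -- A boundary layer on which the defining function has no critical point.
  obtain ⟨ε, hε, hεS⟩ : ∃ ε > 0, ∀ x ∈ closure Ω, ε ≤ max (∑ i, sgrad ρ x i ^ 2) (-ρ x) := by
    have hgc : Continuous (sgrad ρ) := (continuous_sgrad_slice (u := fun y _ => ρ y) hρpair).comp
      (continuous_id.prodMk (continuous_const (y := (0 : ℝ))))
    refine hcl.exists_forall_le' (f := fun x => max (∑ i, sgrad ρ x i ^ 2) (-ρ x))
      (Continuous.continuousOn ?_) (fun x hx => ?_)
    · exact (continuous_finsetSum _ fun i _ => ((continuous_apply i).comp hgc).pow 2).max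
        hρ2.continuous.neg
    · rcases (hρcl x hx).lt_or_eq with h | h
      · exact lt_max_of_lt_right (by linarith)
      · refine lt_max_of_lt_left ?_
        have hfr : x ∈ frontier Ω := by
          rw [hΩo.frontier_eq]
          refine ⟨hx, fun hx' => ?_⟩
          rw [hΩρ] at hx'
          exact hx'.ne h
        refine lt_of_le_of_ne (Finset.sum_nonneg fun i _ => sq_nonneg _) fun h0 => hdρ x hfr ?_
        have hz := (Finset.sum_eq_zero_iff_of_nonneg fun i _ => sq_nonneg (sgrad ρ x i)).mp h0.symm
        refine ContinuousLinearMap.coe_injective (LinearMap.pi_ext' fun i => LinearMap.ext_ring ?_)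
        simpa [sgrad] using hz i (Finset.mem_univ i)
  -- Bound for `sup u` from a barrier depending on one coordinate.
  let i₀ : Fin n := ⟨0, by omega⟩
  obtain ⟨κ₁, hκ₁, K₁, hK₁, hbar₁⟩ := exists_expBarrier (n := n) (C₁ := 2 * |MA|) (M := 1) (c₀ := 1)
    (R := R) (by positivity) (by norm_num) (by norm_num)
  set N : ℝ := Mφ + K₁ * Real.exp (κ₁ * R) with hN
  have hupper : ∀ u : (Fin n → ℝ) → ℝ → ℝ, RegN 2 u → Admissible Γ A u (QTbar Ω T) →
      (∀ q ∈ PQ Ω T, u q.1 q.2 = φ q.1 q.2) → ∀ q ∈ QTbar Ω T, u q.1 q.2 ≤ N := by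
    rintro u hu hadm hbdry ⟨x, t⟩ ⟨hx, ht⟩
    have hcoord : ∀ y : Fin n → ℝ, sgrad (fun y : Fin n → ℝ => y i₀) y = Pi.single i₀ 1 := by
      intro y
      funext i
      have := ((ContinuousLinearMap.proj i₀ : (Fin n → ℝ) →L[ℝ] ℝ).hasFDerivAt (x := y)).fderiv
      change fderiv ℝ (fun y : Fin n → ℝ => y i₀) y = _ at this
      rw [sgrad, this]
      simp [Pi.single_apply, eq_comm]
    have h := hbar₁ K₁ le_rfl (fun y => u y t) (fun _ => 0) (fun y => y i₀) N Ω
      (fun y p => (A y t p).trace) (contDiff_slice hu t) contDiff_const (contDiff_apply ℝ ℝ i₀)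
      hΩo hΩb (fun y hy p => hgrowth y (subset_closure hy) t ht p) ?_ ?_ ?_ ?_ ?_ ?_ x hx
    · have : 0 ≤ K₁ * Real.exp (κ₁ * x i₀) := by positivity
      simp only [zero_add] at h
      linarith
    · intro y _
      constructor
      · simp [slap, shess]
      · have h0 : sgrad (fun _ : Fin n → ℝ => (0 : ℝ)) y = 0 := by
          funext i
          simp [sgrad]
        rw [h0, norm_zero]
        exact zero_le_one
    · intro y _
      constructor
      · have : ∀ i : Fin n, (fun z => fderiv ℝ (fun y : Fin n → ℝ => y i₀) z (Pi.single i 1))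
            = fun _ => (Pi.single i₀ 1 : Fin n → ℝ) i := fun i => funext fun z =>
          congrFun (hcoord z) i
        simp [slap, shess, this]
      · rw [hcoord y]
        refine (pi_norm_le_iff_of_nonneg zero_le_one).mpr fun i => ?_
        by_cases hi : i = i₀ <;> simp [hi]
    · intro y _
      rw [hcoord y]
      simp [Pi.single_apply]
    · intro y hy
      have := (norm_le_pi_norm y i₀).trans (hR y (subset_closure hy))
      exact (abs_le.mp this).1
    · intro y hy
      exact slap_add_trace_pos hΓ (hadm (y, t) ⟨subset_closure hy, ht⟩)
    · intro y hy
      have hycl := frontier_subset_closure hy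
      have h1 : u y t = φ y t := hbdry (y, t) (Or.inr ⟨hy, ht⟩)
      have h2 := (abs_le.mp (hMφ (y, t) ⟨hycl, ht⟩)).2
      have h3 := (abs_le.mp ((norm_le_pi_norm y i₀).trans (hR y hycl))).2
      have h4 : K₁ * Real.exp (κ₁ * y i₀) ≤ K₁ * Real.exp (κ₁ * R) := by
        gcongr
      simp only at h2 ⊢
      linarith
  -- Boundary gradient estimate from a barrier built on the defining function.
  set M : ℝ := |Lφ| + |Gφ| + |Lρ| + |Gρ| with hMdef
  have hLφM : |Lφ| ≤ M := by rw [hMdef]; linarith [abs_nonneg Gφ, abs_nonneg Lρ, abs_nonneg Gρ]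
  have hGφM : |Gφ| ≤ M := by rw [hMdef]; linarith [abs_nonneg Lφ, abs_nonneg Lρ, abs_nonneg Gρ]
  have hLρM : |Lρ| ≤ M := by rw [hMdef]; linarith [abs_nonneg Gφ, abs_nonneg Lφ, abs_nonneg Gρ]
  have hGρM : |Gρ| ≤ M := by rw [hMdef]; linarith [abs_nonneg Gφ, abs_nonneg Lφ, abs_nonneg Lρ]
  have hM0 : 0 ≤ M := (abs_nonneg _).trans hLφM
  obtain ⟨κ, hκ, K₀, hK₀, hbar⟩ := exists_expBarrier (n := n) (C₁ := 2 * |MA|) (M := M) (c₀ := ε)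
    (R := ε) (by positivity) hM0 hε
  have hexpε : 0 < 1 - Real.exp (κ * -ε) := by
    rw [sub_pos, Real.exp_lt_one_iff]
    nlinarith
  set K : ℝ := K₀ + |N + Mφ| / (1 - Real.exp (κ * -ε)) with hK
  have hKK₀ : K₀ ≤ K := le_add_of_nonneg_right (by positivity)
  have hK0 : 0 ≤ K := hK₀.le.trans hKK₀
  have hKN : N + Mφ ≤ K * (1 - Real.exp (κ * -ε)) := by
    rw [hK, add_mul, div_mul_cancel₀ _ hexpε.ne']
    have : 0 ≤ K₀ * (1 - Real.exp (κ * -ε)) := by positivity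
    linarith [le_abs_self (N + Mφ)]
  have hlayer : ∀ u : (Fin n → ℝ) → ℝ → ℝ, RegN 2 u → Admissible Γ A u (QTbar Ω T) →
      (∀ q ∈ PQ Ω T, u q.1 q.2 = φ q.1 q.2) → ∀ t ∈ Set.Icc 0 T, ∀ x, ρ x < 0 → -ε < ρ x →
      u x t ≤ φ x t + K - K * Real.exp (κ * ρ x) := by
    intro u hu hadm hbdry t ht x hx1 hx2
    have hDΩ : Ω ∩ {y | -ε < ρ y} ⊆ closure Ω := Set.inter_subset_left.trans subset_closure
    have hDo : IsOpen (Ω ∩ {y | -ε < ρ y}) :=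
      hΩo.inter (isOpen_lt continuous_const hρ2.continuous)
    refine hbar K hKK₀ (fun y => u y t) (fun y => φ y t) ρ K (Ω ∩ {y | -ε < ρ y})
      (fun y p => (A y t p).trace) (contDiff_slice hu t) (contDiff_slice hφ2 t) hρ2
      hDo (hΩb.subset Set.inter_subset_left)
      (fun y hy p => hgrowth y (hDΩ hy) t ht p) ?_ ?_ ?_ ?_ ?_ ?_ x
      (subset_closure ⟨by rw [hΩρ]; exact hx1, hx2⟩)
    · intro y hy
      have hy := hDΩ hy
      exact ⟨(le_abs_self _).trans ((hLφ (y, t) ⟨hy, ht⟩).trans ((le_abs_self _).trans hLφM)),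
        (hGφ (y, t) ⟨hy, ht⟩).trans ((le_abs_self _).trans hGφM)⟩
    · intro y hy
      have hy := hDΩ hy
      exact ⟨(abs_le.mp ((hLρ (y, t) ⟨hy, ht⟩).trans ((le_abs_self _).trans hLρM))).1,
        (hGρ (y, t) ⟨hy, ht⟩).trans ((le_abs_self _).trans hGρM)⟩
    · intro y hy
      have hyε : -ε < ρ y := hy.2
      rcases le_max_iff.mp (hεS y (hDΩ hy)) with h | h
      · exact h
      · linarith
    · exact fun y hy => hy.2.le
    · exact fun y hy => slap_add_trace_pos hΓ (hadm (y, t) ⟨hDΩ hy, ht⟩)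
    · intro y hy
      rw [hDo.frontier_eq] at hy
      have hycl : y ∈ closure Ω := closure_mono Set.inter_subset_left hy.1
      by_cases hyΩ : y ∈ Ω
      · have hge : -ε ≤ ρ y := closure_minimal (t := {y | -ε ≤ ρ y})
          (fun z hz => le_of_lt (show -ε < ρ z from hz.2)) (isClosed_le continuous_const hρ2.continuous) hy.1
        have hle : ρ y ≤ -ε := by
          by_contra! h
          exact hy.2 ⟨hyΩ, h⟩
        rw [le_antisymm hle hge]
        have h1 : u y t ≤ N := hupper u hu hadm hbdry (y, t) ⟨hycl, ht⟩
        have h2 := (abs_le.mp (hMφ (y, t) ⟨hycl, ht⟩)).1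
        simp only at h2 ⊢
        linarith
      · have hyfr : y ∈ frontier Ω := by rw [hΩo.frontier_eq]; exact ⟨hycl, hyΩ⟩
        have h1 : u y t = φ y t := hbdry (y, t) (Or.inr ⟨hyfr, ht⟩)
        simp [hρfr y hyfr, h1]
  refine ⟨1 + |N| + |Mub| + |Gub| + |Gφ| + K * κ * |Gρ|, by positivity, ?_⟩
  intro u hu hadm _ hbdry hge
  have hKG : 0 ≤ K * κ * |Gρ| := by positivity
  refine ⟨fun q hq => ?_, fun q hq => ?_⟩
  · have h1 := hupper u hu hadm hbdry q hq
    have h2 := (abs_le.mp (hMub q hq)).1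
    have h3 := hge q hq
    rw [abs_le]
    constructor <;>
    linarith [le_abs_self N, le_abs_self Mub, abs_nonneg N, abs_nonneg Mub, abs_nonneg Gub,
      abs_nonneg Gφ]
  · have hlat : ∀ x ∈ frontier Ω, ∀ t ∈ Set.Icc 0 T, ‖sgrad (fun y => u y t) x‖
        ≤ 1 + |N| + |Mub| + |Gub| + |Gφ| + K * κ * |Gρ| := by
      intro x hx t ht
      have hxQ : (x, t) ∈ QTbar Ω T := ⟨frontier_subset_closure hx, ht⟩
      have hux : u x t = φ x t := hbdry (x, t) (Or.inr ⟨hx, ht⟩)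
      have hφt := (contDiff_slice hφ2 t)
      refine norm_sgrad_le_of_squeeze (ρ := ρ) (lo := fun y => ub y t)
        (hi := fun y => φ y t + K - K * Real.exp (κ * ρ y)) (ε := ε)
        (hρ2.differentiable (by norm_num) x)
        ((contDiff_slice hu t).differentiable (by norm_num) x)
        ((contDiff_slice hub2 t).differentiable (by norm_num) x)
        ((contDiff_expBarrier hφt hρ2 K K κ).differentiable (by norm_num) x)
        hε (hρfr x hx) (hdρ x hx) ?_ ?_ ?_ ?_ ?_
      · simp only [hux, hubφ x hx t ht]
      · simp [hux, hρfr x hx]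
      · intro y h1 h2
        refine ⟨hge (y, t) ⟨subset_closure (by rw [hΩρ]; exact h1), ht⟩, ?_⟩
        exact hlayer u hu hadm hbdry t ht y h1 h2
      · have := hGub (x, t) hxQ
        linarith [le_abs_self Gub, abs_nonneg N, abs_nonneg Mub, abs_nonneg Gφ]
      · have hs : sgrad (fun y => φ y t + K - K * Real.exp (κ * ρ y)) x
            = sgrad (fun y => φ y t) x - (K * κ) • sgrad ρ x := by
          funext i
          have := fderiv_expBarrier (hφt.differentiable (by norm_num) x)
            (hρ2.differentiable (by norm_num) x) K K κ (Pi.single i 1)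
          rw [hρfr x hx, mul_zero, Real.exp_zero, mul_one] at this
          exact this
        rw [hs]
        refine (norm_sub_le _ _).trans ?_
        rw [norm_smul, Real.norm_of_nonneg (by positivity : 0 ≤ K * κ)]
        have h1 := (hGφ (x, t) hxQ).trans (le_abs_self _)
        have h2 := mul_le_mul_of_nonneg_left ((hGρ (x, t) hxQ).trans (le_abs_self _))
          (by positivity : 0 ≤ K * κ)
        simp only at h1 h2
        linarith [abs_nonneg N, abs_nonneg Mub, abs_nonneg Gub]
    obtain ⟨x, t⟩ := q
    rcases hq with ⟨hx, ht⟩ | ⟨hx, ht⟩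
    · simp only at hx ht ⊢
      obtain rfl : t = 0 := ht
      by_cases hxΩ : x ∈ Ω
      · have heq : (fun y => u y 0) =ᶠ[𝓝 x] fun y => φ y 0 := by
          filter_upwards [hΩo.mem_nhds hxΩ] with y hy
          exact hbdry (y, 0) (Or.inl ⟨subset_closure hy, rfl⟩)
        have hs : sgrad (fun y => u y 0) x = sgrad (fun y => φ y 0) x := by
          funext i
          rw [sgrad, sgrad, heq.fderiv_eq]
        rw [hs]
        have := hGφ (x, 0) (hmem0 x hx)
        simp only at this
        linarith [le_abs_self Gφ, abs_nonneg N, abs_nonneg Mub, abs_nonneg Gub]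
      · exact hlat x (by rw [hΩo.frontier_eq]; exact ⟨hx, hxΩ⟩) 0 ⟨le_rfl, hT.le⟩
    · exact hlat x hx t ht

end ParabolicHessian
end
end

section
/- Let u ∈ C³(Q̄_T) be an admissible solution of equation (E). Assume (f1), (f2), (A2), the growth conditions (A1) with γ₁ < 4 and γ₂ < 4, that f is positively homogeneous of degree one on Γ (f4), condition (f6), and the growth conditions (p-A5), (p-A500) and (p-G20**) with exponent γ < 2. Then for every K > 0 there exists a constant C₃ > 0, depending only on n, Ω, T, f, Γ, A, ψ, ν₁ and K, such that whenever sup_{Q̄_T} |u| ≤ K, one has max_{Q̄_T} |Du| ≤ C₃ (1 + max_{𝒫Q_T} |Du|). -/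
open scoped BigOperators Topology

noncomputable section

namespace ParabolicHessian

open Matrix in
lemma qform_eq_dotProduct {n : ℕ} (S : Mat n) (ξ : Fin n → ℝ) : qform S ξ = ξ ⬝ᵥ (S *ᵥ ξ) := by
  simp only [qform, dotProduct, mulVec, Finset.mul_sum, mul_assoc]

open Matrix in
lemma dotProduct_orthonormal_sum {n : ℕ} {V : Fin n → Fin n → ℝ}
    (hV : ∀ k l, V k ⬝ᵥ V l = if k = l then 1 else 0) (a b : Fin n → ℝ) :
    (∑ k, a k • V k) ⬝ᵥ (∑ k, b k • V k) = ∑ k, a k * b k := by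
  simp [sum_dotProduct, dotProduct_sum, hV, mul_comm]

open Matrix in
/-- Orthonormal diagonalization of a real symmetric matrix, in coordinates. -/
lemma exists_eigenframe {n : ℕ} (S : Mat n) (h : S.IsHermitian) :
    ∃ V : Fin n → Fin n → ℝ, (∀ w, ∑ k, (V k ⬝ᵥ w) • V k = w) ∧
      (∀ k l, V k ⬝ᵥ V l = if k = l then 1 else 0) ∧
      ∀ a : Fin n → ℝ, qform S (∑ k, a k • V k) = ∑ k, eigenVec S k * a k ^ 2 := by
  have hon : ∀ k l, (h.eigenvectorBasis k).ofLp ⬝ᵥ (h.eigenvectorBasis l).ofLp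
      = if k = l then (1 : ℝ) else 0 := by
    intro k l
    have := orthonormal_iff_ite.1 h.eigenvectorBasis.orthonormal k l
    rw [EuclideanSpace.inner_eq_star_dotProduct] at this
    simpa [dotProduct_comm] using this
  refine ⟨fun k => (h.eigenvectorBasis k).ofLp, fun w => ?_, hon, fun a => ?_⟩
  · have := congrArg WithLp.ofLp (h.eigenvectorBasis.sum_repr' (WithLp.toLp 2 w))
    simpa [EuclideanSpace.inner_eq_star_dotProduct, dotProduct_comm, WithLp.ofLp_sum] using this
  · have hS : S *ᵥ (∑ k, a k • (h.eigenvectorBasis k).ofLp)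
        = ∑ k, (eigenVec S k * a k) • (h.eigenvectorBasis k).ofLp := by
      rw [mulVec_sum]
      refine Finset.sum_congr rfl fun k _ => ?_
      rw [mulVec_smul, h.mulVec_eigenvectorBasis, smul_smul, eigenVec, dif_pos h, mul_comm]
    rw [qform_eq_dotProduct, hS, dotProduct_orthonormal_sum hon]
    exact Finset.sum_congr rfl fun k _ => by ring

lemma permMatrix_sum {n : ℕ} (σ : Equiv.Perm (Fin n)) (g b : Fin n → ℝ) :
    ∑ j, ∑ k, g j * Equiv.Perm.permMatrix ℝ σ j k * b k = ∑ j, g j * b (σ j) := by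
  simp [Equiv.Perm.permMatrix, PEquiv.toMatrix_apply, Equiv.toPEquiv_apply]

/-- A bilinear expression in a doubly stochastic matrix is bounded below as soon as it is so
on permutation matrices. -/
lemma le_sum_doublyStochastic {n : ℕ} {D : Mat n} (hD : D ∈ doublyStochastic ℝ (Fin n))
    (g b : Fin n → ℝ) (c : ℝ) (h : ∀ σ : Equiv.Perm (Fin n), c ≤ ∑ j, g j * b (σ j)) :
    c ≤ ∑ j, ∑ k, g j * D j k * b k := by
  let L : Mat n →ₗ[ℝ] ℝ :=
    { toFun := fun E => ∑ j, ∑ k, g j * E j k * b k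
      map_add' := fun E E' => by
        simp only [Matrix.add_apply, mul_add, add_mul, Finset.sum_add_distrib]
      map_smul' := fun r E => by
        simp only [Matrix.smul_apply, smul_eq_mul, RingHom.id_apply, Finset.mul_sum]
        exact Finset.sum_congr rfl fun j _ => Finset.sum_congr rfl fun k _ => by ring }
  have hconv : Convex ℝ {E : Mat n | c ≤ L E} := convex_halfSpace_ge L.isLinear c
  have hsub : (doublyStochastic ℝ (Fin n) : Set (Mat n)) ⊆ {E : Mat n | c ≤ L E} := by
    rw [doublyStochastic_eq_convexHull_permMatrix]
    refine convexHull_min ?_ hconv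
    rintro _ ⟨σ, rfl⟩
    exact (h σ).trans_eq (permMatrix_sum σ g b).symm
  exact hsub hD

/-- One-sided first derivative test. -/
lemma deriv_le_of_eventually_le {h : ℝ → ℝ} {h' a b : ℝ} (hd : HasDerivAt h h' 0)
    (hle : ∀ᶠ s in 𝓝[>] (0 : ℝ), h s ≤ h 0 + a * s + b * s ^ 2) : h' ≤ a := by
  have h1 := hd.tendsto_slope_zero_right
  have h2 : Filter.Tendsto (fun s : ℝ => a + b * s) (𝓝[>] 0) (𝓝 a) := by
    have : Filter.Tendsto (fun s : ℝ => a + b * s) (𝓝 0) (𝓝 (a + b * 0)) := by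
      apply Continuous.tendsto; fun_prop
    simpa using this.mono_left nhdsWithin_le_nhds
  refine le_of_tendsto_of_tendsto h1 h2 ?_
  filter_upwards [hle, self_mem_nhdsWithin] with s hs hpos
  have hpos' : (0 : ℝ) < s := hpos
  rw [zero_add, smul_eq_mul, inv_mul_le_iff₀ hpos']
  nlinarith

/-- Tangent inequality for concave functions. -/
lemma ConcaveOn.le_tangent {E : Type*} [NormedAddCommGroup E] [NormedSpace ℝ E] {s : Set E}
    {g : E → ℝ} (hg : ConcaveOn ℝ s g) {x y : E} (hx : x ∈ s) (hy : y ∈ s)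
    (hd : DifferentiableAt ℝ g x) : g y ≤ g x + fderiv ℝ g x (y - x) := by
  have hline : HasDerivAt (fun τ : ℝ => -g (x + τ • (y - x))) (-(fderiv ℝ g x (y - x))) 0 := by
    have h1 : HasDerivAt (fun τ : ℝ => x + τ • (y - x)) (y - x) 0 := by
      simpa using ((hasDerivAt_id (0 : ℝ)).smul_const (y - x)).const_add x
    have h2 : HasFDerivAt g (fderiv ℝ g x) (x + (0 : ℝ) • (y - x)) := by
      simpa using hd.hasFDerivAt
    exact (h2.comp_hasDerivAt 0 h1).neg
  have := deriv_le_of_eventually_le (a := -(g y - g x)) (b := 0) hline (by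
    filter_upwards [Ioo_mem_nhdsGT (zero_lt_one' ℝ)] with τ hτ
    have := hg.2 hx hy (sub_nonneg.2 hτ.2.le) hτ.1.le (by ring)
    have e : (1 - τ) • x + τ • y = x + τ • (y - x) := by module
    rw [e] at this
    simp only [smul_eq_mul] at this
    simp only [zero_smul, add_zero]
    linarith)
  linarith

lemma clm_apply_eq_sum {n : ℕ} (L : (Fin n → ℝ) →L[ℝ] ℝ) (ξ : Fin n → ℝ) :
    L ξ = ∑ i, ξ i * L (Pi.single i 1) := by
  have := L.toLinearMap.pi_apply_eq_sum_univ ξ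
  simp only [ContinuousLinearMap.coe_coe, smul_eq_mul] at this
  rw [this]
  refine Finset.sum_congr rfl fun i _ => ?_
  congr 2
  ext j
  simp [Pi.single_apply, eq_comm]

/-- Tangent inequality and Euler's identity for `f`. -/
lemma le_sum_fLam {n : ℕ} {Γ : Set (Fin n → ℝ)} (hΓo : IsOpen Γ) {f : (Fin n → ℝ) → ℝ}
    (hfs : ContDiffOn ℝ (⊤ : ℕ∞) f Γ) (hf2 : F2cond Γ f)
    (hf4 : ∀ lam ∈ Γ, ∀ s : ℝ, 0 < s → f (s • lam) = s * f lam) {μ : Fin n → ℝ} (hμ : μ ∈ Γ) :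
    f μ = ∑ j, fLam f μ j * μ j ∧ ∀ lam ∈ Γ, f lam ≤ ∑ j, fLam f μ j * lam j := by
  have hd : DifferentiableAt ℝ f μ :=
    (hfs.contDiffAt (hΓo.mem_nhds hμ)).differentiableAt (by simp)
  have hsum : ∀ v, fderiv ℝ f μ v = ∑ j, fLam f μ j * v j := fun v => by
    rw [clm_apply_eq_sum]
    exact Finset.sum_congr rfl fun j _ => mul_comm _ _
  have euler : fderiv ℝ f μ μ = f μ := by
    have h1 : HasDerivAt (fun s : ℝ => s • μ) μ 1 := by
      simpa using (hasDerivAt_id (1 : ℝ)).smul_const μ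
    have h2 : HasFDerivAt f (fderiv ℝ f μ) ((1 : ℝ) • μ) := by simpa using hd.hasFDerivAt
    have h3 := h2.comp_hasDerivAt 1 h1
    have h4 : HasDerivAt (fun s : ℝ => s * f μ) (f μ) 1 := by
      simpa using (hasDerivAt_id (1 : ℝ)).mul_const (f μ)
    refine h3.unique (h4.congr_of_eventuallyEq ?_)
    filter_upwards [Ioi_mem_nhds (zero_lt_one' ℝ)] with s hs
    exact hf4 μ hμ s hs
  refine ⟨by rw [← hsum, euler], fun lam hlam => ?_⟩
  have := ConcaveOn.le_tangent hf2 hμ hlam hd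
  rw [map_sub, euler] at this
  rw [← hsum]
  linarith

/-- Pushing down the negative entries of `lam` less than `f` loses: the combinatorial core of the
comparison of `f` at two matrices. -/
lemma le_sum_perm {n : ℕ} {lam g b : Fin n → ℝ} {F κ τ ε : ℝ} (hg : ∀ j, 0 ≤ g j) (hτ : 0 ≤ τ)
    (hτκ : 8 * τ ≤ κ) (k₀ : Fin n) (hk₀ : ∀ k, lam k₀ ≤ lam k) (hlam : lam k₀ ≤ -κ / 2)
    (hκ : 0 < κ) (hb : ∀ k, b k = lam k + (if lam k < -κ / 4 then τ else 0) - ε)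
    (hF : ∀ σ : Equiv.Perm (Fin n), F ≤ ∑ j, g j * lam (σ j)) (σ : Equiv.Perm (Fin n)) :
    F + (∑ j, g j) * (τ / n - ε) ≤ ∑ j, g j * b (σ j) := by
  classical
  have hn0 : (0 : ℝ) < n := by exact_mod_cast (Fin.pos k₀)
  obtain ⟨j₁, -, hj₁⟩ := Finset.exists_max_image Finset.univ g ⟨k₀, Finset.mem_univ _⟩
  have hbmin : ∀ k, b k₀ ≤ b k := by
    intro k
    rw [hb, hb, if_pos (by linarith)]
    split_ifs with h
    · linarith [hk₀ k]
    · linarith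
  set j₀ := σ.symm k₀ with hj₀
  have hσj₀ : σ j₀ = k₀ := by simp [hj₀]
  let σ' : Equiv.Perm (Fin n) := (Equiv.swap j₀ j₁).trans σ
  have hσ' : σ' j₁ = k₀ := by simp [σ', hσj₀]
  have hswap : ∑ j, g j * b (σ' j) ≤ ∑ j, g j * b (σ j) := by
    by_cases hj : j₀ = j₁
    · have : σ' = σ := by ext j; simp [σ', hj]
      rw [this]
    · rw [← sub_nonneg, ← Finset.sum_sub_distrib]
      have hsupp : ∑ j, (g j * b (σ j) - g j * b (σ' j))
          = ∑ j ∈ ({j₀, j₁} : Finset (Fin n)), (g j * b (σ j) - g j * b (σ' j)) := by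
        symm
        refine Finset.sum_subset (Finset.subset_univ _) fun j _ hj' => ?_
        simp only [Finset.mem_insert, Finset.mem_singleton, not_or] at hj'
        have : σ' j = σ j := by simp [σ', Equiv.swap_apply_of_ne_of_ne hj'.1 hj'.2]
        rw [this, sub_self]
      rw [hsupp, Finset.sum_pair hj, hσ', hσj₀]
      have : σ' j₀ = σ j₁ := by simp [σ']
      rw [this]
      nlinarith [hj₁ j₀ (Finset.mem_univ _), hbmin (σ j₁)]
  refine le_trans ?_ hswap
  have hsplit : ∑ j, g j * b (σ' j) = ∑ j, g j * lam (σ' j)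
      + ∑ j, g j * (if lam (σ' j) < -κ / 4 then τ else 0) - (∑ j, g j) * ε := by
    rw [Finset.sum_mul, ← Finset.sum_add_distrib, ← Finset.sum_sub_distrib]
    exact Finset.sum_congr rfl fun j _ => by rw [hb]; ring
  have hone : g j₁ * τ ≤ ∑ j, g j * (if lam (σ' j) < -κ / 4 then τ else 0) := by
    have h1 : g j₁ * (if lam (σ' j₁) < -κ / 4 then τ else 0) = g j₁ * τ := by
      rw [hσ', if_pos (by linarith)]
    rw [← h1]
    refine Finset.single_le_sum (f := fun j => g j * (if lam (σ' j) < -κ / 4 then τ else 0))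
      (fun j _ => mul_nonneg (hg j) ?_) (Finset.mem_univ j₁)
    split_ifs <;> linarith
  have havg : (∑ j, g j) / n ≤ g j₁ := by
    rw [div_le_iff₀ hn0]
    calc ∑ j, g j ≤ ∑ _j : Fin n, g j₁ := Finset.sum_le_sum fun j hj => hj₁ j hj
      _ = g j₁ * n := by simp [mul_comm]
  have : (∑ j, g j) * (τ / n - ε) = (∑ j, g j) / n * τ - (∑ j, g j) * ε := by ring
  rw [hsplit, this]
  nlinarith [hF σ', mul_le_mul_of_nonneg_right havg hτ]

open Matrix in
/-- If the quadratic forms of `S` and `T` satisfy the two-point inequality and `S` is quite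
negative in some direction, then `f(λ(T))` exceeds `f(λ(S))` by a definite amount. -/
lemma f_gain_of_two_point {n : ℕ} {Γ : Set (Fin n → ℝ)} (hΓ : GoodCone Γ)
    {f : (Fin n → ℝ) → ℝ} (hfs : SmoothSymF Γ f) (hf1 : F1cond Γ f) (hf2 : F2cond Γ f)
    (hf4 : ∀ lam ∈ Γ, ∀ s : ℝ, 0 < s → f (s • lam) = s * f lam)
    {S T : Mat n} (hS : S.IsHermitian) (hT : T.IsHermitian)
    (hSΓ : eigenVec S ∈ Γ) (hTΓ : eigenVec T ∈ Γ) {κ ζ τ C : ℝ} (hκ : 0 < κ) (hτ : 0 ≤ τ)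
    (hC : 0 ≤ C) (hτκ : 8 * τ ≤ κ) (hτζ : 64 * τ * ζ ≤ κ ^ 2)
    {e : Fin n → ℝ} (he : e ⬝ᵥ e = 1) (hSe : qform S e ≤ -κ / 2)
    (hST : ∀ ξ η : Fin n → ℝ, qform S ξ - qform T η
      ≤ ζ * ((ξ - η) ⬝ᵥ (ξ - η)) + C * (ξ ⬝ᵥ ξ + η ⬝ᵥ η)) :
    f (eigenVec S) + (∑ j, fLam f (eigenVec T) j) * (τ / n - 2 * C) ≤ f (eigenVec T) := by
  obtain ⟨V, hVrep, hVon, hVq⟩ := exists_eigenframe S hS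
  obtain ⟨W, hWrep, hWon, hWq⟩ := exists_eigenframe T hT
  set lam := eigenVec S
  set μ := eigenVec T
  set g := fLam f μ
  have hg : ∀ j, 0 < g j := hf1 μ hTΓ
  obtain ⟨heuler, htan⟩ := le_sum_fLam hΓ.1 hfs.1 hf2 hf4 hTΓ
  have hnorm : ∀ w, ∑ k, (V k ⬝ᵥ w) ^ 2 = w ⬝ᵥ w := fun w => by
    conv_rhs => rw [← hVrep w, dotProduct_orthonormal_sum hVon]
    exact Finset.sum_congr rfl fun k _ => by ring
  have hnormW : ∀ w, ∑ j, (W j ⬝ᵥ w) ^ 2 = w ⬝ᵥ w := fun w => by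
    conv_rhs => rw [← hWrep w, dotProduct_orthonormal_sum hWon]
    exact Finset.sum_congr rfl fun k _ => by ring
  have hne : Nonempty (Fin n) := by
    by_contra hcon
    rw [not_nonempty_iff] at hcon
    simp [dotProduct] at he
  obtain ⟨k₀, -, hk₀⟩ := Finset.exists_min_image Finset.univ lam Finset.univ_nonempty
  have hlam0 : lam k₀ ≤ -κ / 2 := by
    refine le_trans ?_ hSe
    rw [← hVrep e, hVq]
    calc lam k₀ = ∑ k, lam k₀ * (V k ⬝ᵥ e) ^ 2 := by
          rw [← Finset.mul_sum, hnorm, he, mul_one]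
      _ ≤ _ := Finset.sum_le_sum fun k hk =>
          mul_le_mul_of_nonneg_right (hk₀ k hk) (sq_nonneg _)
  let b : Fin n → ℝ := fun k => lam k + (if lam k < -κ / 4 then τ else 0) - 2 * C
  let D : Mat n := Matrix.of fun j k => (V k ⬝ᵥ W j) ^ 2
  have hD : D ∈ doublyStochastic ℝ (Fin n) := by
    rw [mem_doublyStochastic_iff_sum]
    refine ⟨fun j k => sq_nonneg _, fun j => ?_, fun k => ?_⟩
    · simpa [D, hWon] using hnorm (W j)
    · simpa [D, hVon, dotProduct_comm] using hnormW (V k)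
  set σ := 8 * τ / κ with hσ
  have hσ0 : 0 ≤ σ := by positivity
  have hσ1 : σ ≤ 1 := by rw [hσ, div_le_one hκ]; exact hτκ
  have hσκ : σ * κ = 8 * τ := by rw [hσ]; field_simp
  have hσζ : σ * ζ ≤ κ / 8 := by
    rw [hσ, div_mul_eq_mul_div, div_le_iff₀ hκ]; nlinarith
  have hμ : ∀ j, ∑ k, D j k * b k ≤ μ j := by
    intro j
    let q : Fin n → ℝ := fun k => if lam k < -κ / 4 then σ else 0
    let a : Fin n → ℝ := fun k => V k ⬝ᵥ W j
    have hη : W j = ∑ k, a k • V k := (hVrep (W j)).symm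
    have hdiff : (∑ k, ((1 - q k) * a k) • V k) - W j = ∑ k, (-(q k * a k)) • V k := by
      rw [hη, ← Finset.sum_sub_distrib]
      exact Finset.sum_congr rfl fun k _ => by module
    have hTj : qform T (W j) = μ j := by
      have := hWq (Pi.single j 1)
      simpa [Pi.single_apply] using this
    have key := hST (∑ k, ((1 - q k) * a k) • V k) (W j)
    rw [hdiff, hTj, hVq, dotProduct_orthonormal_sum hVon, dotProduct_orthonormal_sum hVon,
      ← hnorm (W j), ← Finset.sum_add_distrib, Finset.mul_sum, Finset.mul_sum,
      ← Finset.sum_add_distrib, sub_le_comm, ← Finset.sum_sub_distrib] at key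
    refine le_trans (Finset.sum_le_sum fun k _ => ?_) key
    change a k ^ 2 * b k ≤ lam k * ((1 - q k) * a k) ^ 2 - (ζ * (-(q k * a k) * -(q k * a k))
      + C * ((1 - q k) * a k * ((1 - q k) * a k) + a k ^ 2))
    have : b k ≤ lam k * (1 - q k) ^ 2 - ζ * q k ^ 2 - C * ((1 - q k) ^ 2 + 1) := by
      simp only [b, q]
      split_ifs with h
      · have h1 : lam k * (1 - σ) ^ 2 ≥ lam k - σ * lam k := by nlinarith [mul_nonneg hσ0 (sub_nonneg.2 hσ1)]
        have h2 : ζ * σ ^ 2 ≤ σ * (κ / 8) := by nlinarith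
        have h4 : (1 - σ) ^ 2 ≤ 1 := by nlinarith
        have h3 : C * ((1 - σ) ^ 2 + 1) ≤ 2 * C := by
          nlinarith [mul_le_mul_of_nonneg_left h4 hC]
        nlinarith
      · linarith
    nlinarith [mul_le_mul_of_nonneg_left this (sq_nonneg (a k))]
  rw [heuler]
  refine le_trans (le_sum_doublyStochastic hD g b _ fun π => ?_) (Finset.sum_le_sum fun j _ =>
    (by
      rw [show ∑ k, g j * D j k * b k = g j * ∑ k, D j k * b k by
        rw [Finset.mul_sum]; exact Finset.sum_congr rfl fun k _ => by ring]
      exact mul_le_mul_of_nonneg_left (hμ j) (hg j).le :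
      ∑ k, g j * D j k * b k ≤ g j * μ j))
  refine le_sum_perm (fun j => (hg j).le) hτ hτκ k₀ (fun k => hk₀ k (Finset.mem_univ _)) hlam0 hκ
    (fun k => rfl) (fun π' => ?_) π
  rw [← hfs.2 π' lam hSΓ]
  exact htan _ (hΓ.2.2.2.1 π' lam hSΓ)

/-- A lower bound for the trace of the linearized operator. -/
lemma exists_le_sum_fLam {n : ℕ} (hn : 2 ≤ n) {Γ : Set (Fin n → ℝ)} (hΓ : GoodCone Γ)
    {f : (Fin n → ℝ) → ℝ} (hfs : SmoothSymF Γ f) (hf1 : F1cond Γ f) (hf2 : F2cond Γ f)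
    (hf4 : ∀ lam ∈ Γ, ∀ s : ℝ, 0 < s → f (s • lam) = s * f lam) :
    ∃ c > 0, ∀ μ ∈ Γ, c ≤ ∑ j, fLam f μ j := by
  have h1 : (fun _ => 1 : Fin n → ℝ) ∈ Γ := hΓ.2.2.2.2.1 fun _ => zero_lt_one
  have : Nonempty (Fin n) := ⟨⟨0, by omega⟩⟩
  refine ⟨f fun _ => 1, ?_, fun μ hμ => ?_⟩
  · rw [(le_sum_fLam hΓ.1 hfs.1 hf2 hf4 h1).1]
    exact Finset.sum_pos (fun j _ => by simpa using hf1 _ h1 j) Finset.univ_nonempty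
  · simpa using (le_sum_fLam hΓ.1 hfs.1 hf2 hf4 hμ).2 _ h1

lemma isHermitian_of_eigenVec_mem {n : ℕ} {Γ : Set (Fin n → ℝ)} (hΓ : GoodCone Γ) {S : Mat n}
    (hS : eigenVec S ∈ Γ) : S.IsHermitian := by
  by_contra h
  rw [eigenVec, dif_neg h] at hS
  refine hΓ.2.2.2.2.2 (Set.eq_univ_of_forall fun x => ?_)
  have hnear : ∀ᶠ s in 𝓝[>] (0 : ℝ), s • x ∈ Γ := by
    refine Filter.Eventually.filter_mono nhdsWithin_le_nhds ?_
    have hc : ContinuousAt (fun s : ℝ => s • x) 0 := by fun_prop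
    exact hc.eventually_mem (by simpa using hΓ.1.mem_nhds hS)
  obtain ⟨s, hs, hpos⟩ := (hnear.and self_mem_nhdsWithin).exists
  have hpos' : (0 : ℝ) < s := hpos
  have := hΓ.2.2.1 _ hs s⁻¹ (inv_pos.2 hpos')
  rwa [smul_smul, inv_mul_cancel₀ hpos'.ne', one_smul] at this

open Matrix in
lemma fderiv_apply_eq_sgrad {n : ℕ} (v : (Fin n → ℝ) → ℝ) (x ξ : Fin n → ℝ) :
    fderiv ℝ v x ξ = sgrad v x ⬝ᵥ ξ := by
  rw [clm_apply_eq_sum]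
  exact Finset.sum_congr rfl fun i _ => mul_comm _ _

lemma hasDerivAt_ray {E : Type*} [NormedAddCommGroup E] [NormedSpace ℝ E] (x ξ : E) (s : ℝ) :
    HasDerivAt (fun s : ℝ => x + s • ξ) ξ s := by
  simpa using ((hasDerivAt_id s).smul_const ξ).const_add x

open Matrix in
lemma hasDerivAt_comp_ray {n : ℕ} {v : (Fin n → ℝ) → ℝ} (hv : ContDiff ℝ 2 v)
    (x ξ : Fin n → ℝ) (s : ℝ) :
    HasDerivAt (fun s : ℝ => v (x + s • ξ)) (sgrad v (x + s • ξ) ⬝ᵥ ξ) s := by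
  rw [← fderiv_apply_eq_sgrad]
  exact ((hv.differentiable (by simp)) _).hasFDerivAt.comp_hasDerivAt s (hasDerivAt_ray x ξ s)

open Matrix in
lemma hasDerivAt_sgrad_comp_ray {n : ℕ} {v : (Fin n → ℝ) → ℝ} (hv : ContDiff ℝ 2 v)
    (x ξ : Fin n → ℝ) (s : ℝ) :
    HasDerivAt (fun s : ℝ => sgrad v (x + s • ξ) ⬝ᵥ ξ) (qform (shess v (x + s • ξ)) ξ) s := by
  have h1 : ∀ j, HasDerivAt (fun s : ℝ => sgrad v (x + s • ξ) j)
      (∑ i, ξ i * shess v (x + s • ξ) i j) s := by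
    intro j
    have hd : Differentiable ℝ fun y => fderiv ℝ v y (Pi.single j 1) :=
      ((hv.fderiv_right (m := 1) (by norm_num)).clm_apply contDiff_const).differentiable (by simp)
    have := (hd (x + s • ξ)).hasFDerivAt.comp_hasDerivAt s (hasDerivAt_ray x ξ s)
    rw [clm_apply_eq_sum] at this
    exact this
  have h2 := HasDerivAt.fun_sum (u := Finset.univ) fun j _ => (h1 j).mul_const (ξ j)
  refine h2.congr_deriv ?_
  simp only [qform, Finset.sum_mul]
  exact Finset.sum_comm

lemma second_derivative_test_of_isLocalMax {g g' : ℝ → ℝ} {g'' : ℝ}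
    (hg : ∀ s, HasDerivAt g (g' s) s) (hg' : HasDerivAt g' g'' 0) (hmax : IsLocalMax g 0) :
    g' 0 = 0 ∧ g'' ≤ 0 := by
  have h0 : g' 0 = 0 := hmax.hasDerivAt_eq_zero (hg 0)
  refine ⟨h0, ?_⟩
  by_contra! hpos
  have hdg : deriv g = g' := funext fun s => (hg s).deriv
  have hmin : IsLocalMin g 0 := by
    refine isLocalMin_of_deriv_deriv_pos ?_ ?_ (hg 0).continuousAt
    · rw [hdg, hg'.deriv]; exact hpos
    · rw [hdg, h0]
  have hconst : g =ᶠ[𝓝 0] fun _ => g 0 := by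
    filter_upwards [hmax, hmin] with s h1 h2
    exact le_antisymm h1 h2
  have h1 : deriv g =ᶠ[𝓝 0] deriv fun _ => g 0 := hconst.deriv
  have h2 := h1.deriv_eq
  rw [hdg, hg'.deriv] at h2
  simp at h2
  exact hpos.ne' h2

open Matrix in
/-- First and second order conditions at a two-point maximum, along the directions `(ξ, η)`. -/
lemma two_point_conditions {n : ℕ} {v : (Fin n → ℝ) → ℝ} (hv : ContDiff ℝ 2 v)
    {x y ξ η : Fin n → ℝ} {a b : ℝ}
    (h : ∀ᶠ s in 𝓝 (0 : ℝ), v (x + s • ξ) - v (y + s • η) - (a * s + b / 2 * s ^ 2) ≤ v x - v y) :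
    sgrad v x ⬝ᵥ ξ - sgrad v y ⬝ᵥ η = a ∧ qform (shess v x) ξ - qform (shess v y) η ≤ b := by
  have h1 : ∀ s : ℝ, HasDerivAt
      (fun s : ℝ => v (x + s • ξ) - v (y + s • η) - (a * s + b / 2 * s ^ 2))
      (sgrad v (x + s • ξ) ⬝ᵥ ξ - sgrad v (y + s • η) ⬝ᵥ η - (a + b * s)) s := by
    intro s
    refine ((hasDerivAt_comp_ray hv x ξ s).sub (hasDerivAt_comp_ray hv y η s)).sub ?_
    have := ((hasDerivAt_id s).const_mul a).add (((hasDerivAt_id s).pow 2).const_mul (b / 2))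
    refine this.congr_deriv ?_
    simp
    ring
  have h2 : HasDerivAt
      (fun s : ℝ => sgrad v (x + s • ξ) ⬝ᵥ ξ - sgrad v (y + s • η) ⬝ᵥ η - (a + b * s))
      (qform (shess v x) ξ - qform (shess v y) η - b) 0 := by
    have hx := hasDerivAt_sgrad_comp_ray hv x ξ 0
    have hy := hasDerivAt_sgrad_comp_ray hv y η 0
    simp only [zero_smul, add_zero] at hx hy
    refine (hx.sub hy).sub ?_
    simpa using ((hasDerivAt_id (0 : ℝ)).const_mul b).const_add a
  have h3 := second_derivative_test_of_isLocalMax h1 h2 (by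
    filter_upwards [h] with s hs
    simpa using hs)
  simp only [zero_smul, add_zero, mul_zero] at h3
  exact ⟨by linarith [h3.1], by linarith [h3.2]⟩

lemma RegN.contDiff_space {n k : ℕ} {u : (Fin n → ℝ) → ℝ → ℝ} (hu : RegN k u) (t : ℝ) :
    ContDiff ℝ k fun y => u y t := by
  have : ContDiff ℝ k fun y : Fin n → ℝ => ((y, t) : (Fin n → ℝ) × ℝ) :=
    contDiff_id.prodMk contDiff_const
  exact ContDiff.comp (g := fun q : (Fin n → ℝ) × ℝ => u q.1 q.2) hu this

lemma RegN.contDiff_time {n k : ℕ} {u : (Fin n → ℝ) → ℝ → ℝ} (hu : RegN k u) (x : Fin n → ℝ) :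
    ContDiff ℝ k (u x) := by
  have : ContDiff ℝ k fun t : ℝ => ((x, t) : (Fin n → ℝ) × ℝ) :=
    contDiff_const.prodMk contDiff_id
  exact ContDiff.comp (g := fun q : (Fin n → ℝ) × ℝ => u q.1 q.2) hu this

/-- Euclidean length of a vector of `Fin n → ℝ`. -/
def euclLen {n : ℕ} (x : Fin n → ℝ) : ℝ := √(dotProduct x x)

open Matrix in
lemma dotProduct_self_nonneg' {n : ℕ} (x : Fin n → ℝ) : 0 ≤ x ⬝ᵥ x :=
  Finset.sum_nonneg fun _ _ => mul_self_nonneg _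

lemma euclLen_nonneg {n : ℕ} (x : Fin n → ℝ) : 0 ≤ euclLen x := Real.sqrt_nonneg _

open Matrix in
lemma euclLen_sq {n : ℕ} (x : Fin n → ℝ) : euclLen x ^ 2 = x ⬝ᵥ x :=
  Real.sq_sqrt (dotProduct_self_nonneg' x)

lemma euclLen_pos {n : ℕ} {x : Fin n → ℝ} (hx : x ≠ 0) : 0 < euclLen x := by
  refine Real.sqrt_pos.2 ((dotProduct_self_nonneg' x).lt_of_ne fun h => hx ?_)
  exact dotProduct_self_eq_zero.1 h.symm

@[simp] lemma euclLen_zero {n : ℕ} : euclLen (0 : Fin n → ℝ) = 0 := by simp [euclLen]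

@[fun_prop]
lemma continuous_euclLen {n : ℕ} : Continuous (euclLen : (Fin n → ℝ) → ℝ) := by
  unfold euclLen dotProduct
  fun_prop

lemma euclLen_smul {n : ℕ} (s : ℝ) (x : Fin n → ℝ) : euclLen (s • x) = |s| * euclLen x := by
  rw [euclLen, euclLen, smul_dotProduct, dotProduct_smul, smul_eq_mul, smul_eq_mul, ← mul_assoc,
    Real.sqrt_mul (mul_self_nonneg s), Real.sqrt_mul_self_eq_abs]

lemma euclLen_neg {n : ℕ} (x : Fin n → ℝ) : euclLen (-x) = euclLen x := by simp [euclLen]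

lemma euclLen_sub_comm {n : ℕ} (x y : Fin n → ℝ) : euclLen (x - y) = euclLen (y - x) := by
  rw [← euclLen_neg, neg_sub]

lemma abs_apply_le_euclLen {n : ℕ} (x : Fin n → ℝ) (i : Fin n) : |x i| ≤ euclLen x := by
  rw [euclLen, ← Real.sqrt_sq_eq_abs]
  refine Real.sqrt_le_sqrt ?_
  rw [sq]
  exact Finset.single_le_sum (f := fun i => x i * x i) (fun _ _ => mul_self_nonneg _)
    (Finset.mem_univ i)

lemma norm_le_euclLen {n : ℕ} (x : Fin n → ℝ) : ‖x‖ ≤ euclLen x :=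
  (pi_norm_le_iff_of_nonneg (euclLen_nonneg x)).2 fun i => abs_apply_le_euclLen x i

open Matrix in
lemma abs_dotProduct_le {n : ℕ} (x y : Fin n → ℝ) : |x ⬝ᵥ y| ≤ n * ‖x‖ * ‖y‖ := by
  calc |x ⬝ᵥ y| ≤ ∑ i, |x i * y i| := Finset.abs_sum_le_sum_abs _ _
    _ ≤ ∑ _i : Fin n, ‖x‖ * ‖y‖ := Finset.sum_le_sum fun i _ => by
        rw [abs_mul]
        exact mul_le_mul (norm_le_pi_norm x i) (norm_le_pi_norm y i) (abs_nonneg _)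
          (norm_nonneg _)
    _ = n * ‖x‖ * ‖y‖ := by simp [mul_assoc]

lemma euclLen_le {n : ℕ} (x : Fin n → ℝ) : euclLen x ≤ n * ‖x‖ := by
  refine Real.sqrt_le_iff.2 ⟨by positivity, ?_⟩
  refine (le_abs_self _).trans ((abs_dotProduct_le x x).trans ?_)
  rcases Nat.eq_zero_or_pos n with rfl | h
  · simp
  · have : (1 : ℝ) ≤ n := by exact_mod_cast h
    nlinarith [mul_nonneg (Nat.cast_nonneg (α := ℝ) n) (sq_nonneg ‖x‖)]

open Matrix in
lemma abs_dotProduct_le_euclLen {n : ℕ} (x y : Fin n → ℝ) :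
    |x ⬝ᵥ y| ≤ euclLen x * euclLen y := by
  refine abs_le_of_sq_le_sq ?_ (mul_nonneg (euclLen_nonneg x) (euclLen_nonneg y))
  rw [mul_pow, euclLen_sq, euclLen_sq]
  have := Finset.sum_mul_sq_le_sq_mul_sq Finset.univ x y
  simpa [dotProduct, sq] using this

open Matrix in
lemma euclLen_add_le {n : ℕ} {w : Fin n → ℝ} (hw : w ≠ 0) (h : Fin n → ℝ) :
    euclLen (w + h) ≤ euclLen w + (w ⬝ᵥ h) / euclLen w + (h ⬝ᵥ h) / (2 * euclLen w) := by
  have hr := euclLen_pos hw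
  have h1 : euclLen (w + h) ^ 2 = euclLen w ^ 2 + 2 * (w ⬝ᵥ h) + h ⬝ᵥ h := by
    rw [euclLen_sq, euclLen_sq, add_dotProduct, dotProduct_add, dotProduct_add,
      dotProduct_comm h w]
    ring
  have h2 : euclLen w + (w ⬝ᵥ h) / euclLen w + (h ⬝ᵥ h) / (2 * euclLen w)
      = (euclLen (w + h) ^ 2 + euclLen w ^ 2) / (2 * euclLen w) := by
    rw [h1]
    field_simp
    ring
  rw [h2, le_div_iff₀ (by positivity)]
  nlinarith [sq_nonneg (euclLen (w + h) - euclLen w)]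

/-- The concave comparison profile `N ρ - c ρ^{3/2}`. -/
def profile (N c ρ : ℝ) : ℝ := N * ρ - c * (ρ * √ρ)

@[simp] lemma profile_zero (N c : ℝ) : profile N c 0 = 0 := by simp [profile]

@[fun_prop]
lemma continuous_profile (N c : ℝ) : Continuous (profile N c) := by
  unfold profile
  fun_prop

lemma profile_le_tangent {N c ρ r : ℝ} (hc : 0 ≤ c) (hρ : 0 ≤ ρ) (hr : 0 < r) :
    profile N c ρ ≤ profile N c r + (N - 3 / 2 * c * √r) * (ρ - r) := by
  obtain ⟨s, hs, rfl⟩ : ∃ s, 0 ≤ s ∧ s ^ 2 = ρ := ⟨√ρ, Real.sqrt_nonneg _, Real.sq_sqrt hρ⟩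
  obtain ⟨a, ha, rfl⟩ : ∃ a, 0 < a ∧ a ^ 2 = r := ⟨√r, Real.sqrt_pos.2 hr, Real.sq_sqrt hr.le⟩
  rw [profile, profile, Real.sqrt_sq hs, Real.sqrt_sq ha.le]
  have : 0 ≤ c * ((s - a) ^ 2 * (s + a / 2)) := by positivity
  nlinarith

lemma profile_le_quadratic {N c ρ r : ℝ} (hc : 0 ≤ c) (hρ : 0 ≤ ρ) (hr : 0 < r)
    (hρr : ρ ≤ 4 * r) :
    profile N c ρ ≤ profile N c r + (N - 3 / 2 * c * √r) * (ρ - r)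
      - c / (4 * √r) * (ρ - r) ^ 2 := by
  obtain ⟨s, hs, rfl⟩ : ∃ s, 0 ≤ s ∧ s ^ 2 = ρ := ⟨√ρ, Real.sqrt_nonneg _, Real.sq_sqrt hρ⟩
  obtain ⟨a, ha, rfl⟩ : ∃ a, 0 < a ∧ a ^ 2 = r := ⟨√r, Real.sqrt_pos.2 hr, Real.sq_sqrt hr.le⟩
  rw [profile, profile, Real.sqrt_sq hs, Real.sqrt_sq ha.le]
  have hsa : s ≤ 2 * a := by
    refine abs_le_of_sq_le_sq' ?_ (by positivity) |>.2
    linarith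
  have h1 : (s + a) ^ 2 / (4 * a) ≤ s + a / 2 := by
    rw [div_le_iff₀ (by positivity)]
    nlinarith [mul_nonneg hs (sub_nonneg.2 hsa)]
  have h2 : c / (4 * a) * (s ^ 2 - a ^ 2) ^ 2 ≤ c * ((s - a) ^ 2 * (s + a / 2)) := by
    calc c / (4 * a) * (s ^ 2 - a ^ 2) ^ 2
        = c * ((s - a) ^ 2 * ((s + a) ^ 2 / (4 * a))) := by
          rw [show (s ^ 2 - a ^ 2) ^ 2 = (s - a) ^ 2 * (s + a) ^ 2 by ring]
          ring
      _ ≤ _ := by gcongr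
  nlinarith

open Matrix in
/-- Consequences of a local maximum of `v(x) - v(y) - profile |x - y|` off the diagonal. -/
lemma two_point_maximum {n : ℕ} {v : (Fin n → ℝ) → ℝ} (hv : ContDiff ℝ 2 v)
    {x y w : Fin n → ℝ} {N c r m : ℝ} (hw : w = x - y) (hw0 : w ≠ 0) (hr : r = euclLen w)
    (hc : 0 ≤ c) (hm : m = N - 3 / 2 * c * √r) (hm0 : 0 ≤ m)
    (hmax : ∀ᶠ q in 𝓝 (x, y), v q.1 - v q.2 - profile N c (euclLen (q.1 - q.2))
      ≤ v x - v y - profile N c r) :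
    sgrad v x = (m / r) • w ∧ sgrad v y = (m / r) • w ∧
      (∀ ξ η : Fin n → ℝ, qform (shess v x) ξ - qform (shess v y) η
        ≤ m / r * ((ξ - η) ⬝ᵥ (ξ - η))) ∧
      qform (shess v x) (r⁻¹ • w) ≤ -(c / (2 * √r)) := by
  have hr0 : 0 < r := hr ▸ euclLen_pos hw0
  have hww : w ⬝ᵥ w = r ^ 2 := by rw [hr, euclLen_sq]
  have hray : ∀ ξ η : Fin n → ℝ, ∀ᶠ s in 𝓝 (0 : ℝ), v (x + s • ξ) - v (y + s • η)
      - profile N c (euclLen (w + s • (ξ - η))) ≤ v x - v y - profile N c r := by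
    intro ξ η
    have hcont : ContinuousAt (fun s : ℝ => (x + s • ξ, y + s • η)) 0 := by fun_prop
    have h0 : (fun s : ℝ => (x + s • ξ, y + s • η)) 0 = (x, y) := by simp
    have := hcont.eventually (h0 ▸ hmax)
    filter_upwards [this] with s hs
    have e : x + s • ξ - (y + s • η) = w + s • (ξ - η) := by rw [hw]; module
    simpa [e] using hs
  have hcond : ∀ ξ η : Fin n → ℝ,
      sgrad v x ⬝ᵥ ξ - sgrad v y ⬝ᵥ η = m * ((w ⬝ᵥ (ξ - η)) / r) ∧
      qform (shess v x) ξ - qform (shess v y) η ≤ m / r * ((ξ - η) ⬝ᵥ (ξ - η)) := by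
    intro ξ η
    refine two_point_conditions hv ?_
    filter_upwards [hray ξ η] with s hs
    have h1 := profile_le_tangent (N := N) hc (euclLen_nonneg (w + s • (ξ - η))) hr0
    have h2 := euclLen_add_le hw0 (s • (ξ - η))
    rw [← hr] at h2
    simp only [dotProduct_smul, smul_dotProduct, smul_eq_mul] at h2
    rw [← hm] at h1
    have h3 : m * (euclLen (w + s • (ξ - η)) - r)
        ≤ m * (s * (w ⬝ᵥ (ξ - η)) / r + s * (s * ((ξ - η) ⬝ᵥ (ξ - η))) / (2 * r)) :=
      mul_le_mul_of_nonneg_left (by linarith) hm0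
    have h4 : m * (s * (w ⬝ᵥ (ξ - η)) / r + s * (s * ((ξ - η) ⬝ᵥ (ξ - η))) / (2 * r))
        = m * ((w ⬝ᵥ (ξ - η)) / r) * s + m / r * ((ξ - η) ⬝ᵥ (ξ - η)) / 2 * s ^ 2 := by
      field_simp
    linarith
  refine ⟨?_, ?_, fun ξ η => (hcond ξ η).2, ?_⟩
  · ext i
    have := (hcond (Pi.single i 1) 0).1
    simp only [dotProduct_zero, sub_zero, dotProduct_single, mul_one] at this
    rw [this, Pi.smul_apply, smul_eq_mul]
    ring
  · ext i
    have := (hcond 0 (Pi.single i 1)).1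
    simp only [dotProduct_zero, zero_sub, dotProduct_single, mul_one, dotProduct_neg] at this
    rw [Pi.smul_apply, smul_eq_mul]
    linear_combination -this
  · have hcond' := two_point_conditions (a := m) (b := -(c / (2 * √r))) (x := x) (y := y)
      (ξ := r⁻¹ • w) (η := 0) hv (by
        filter_upwards [hray (r⁻¹ • w) 0, Ioo_mem_nhds (neg_lt_zero.2 hr0) hr0] with s hs hsr
        have e : euclLen (w + s • (r⁻¹ • w - 0)) = r + s := by
          have : w + s • (r⁻¹ • w - 0) = (1 + s * r⁻¹) • w := by module
          have h1 : (1 + s * r⁻¹) * r = r + s := by field_simp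
          have h2 : 0 ≤ 1 + s * r⁻¹ := by
            by_contra! hneg
            nlinarith [hsr.1]
          rw [this, euclLen_smul, ← hr, abs_of_nonneg h2, h1]
        have h1 := profile_le_quadratic (N := N) (ρ := r + s) hc (by linarith [hsr.1]) hr0
          (by linarith [hsr.2])
        rw [e] at hs
        rw [← hm] at h1
        have h2 : c / (4 * √r) * (r + s - r) ^ 2 = c / (2 * √r) / 2 * s ^ 2 := by
          field_simp
          ring
        linarith)
    have h0 : qform (shess v y) 0 = 0 := by simp [qform]
    linarith [hcond'.2]

open Matrix in
lemma abs_qform_le {n : ℕ} {S : Mat n} {b : ℝ} (hb : ∑ i, ∑ j, |S i j| ≤ b) (ξ : Fin n → ℝ) :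
    |qform S ξ| ≤ b * (ξ ⬝ᵥ ξ) := by
  calc |qform S ξ| ≤ ∑ i, ∑ j, |ξ i * S i j * ξ j| :=
        (Finset.abs_sum_le_sum_abs _ _).trans
          (Finset.sum_le_sum fun i _ => Finset.abs_sum_le_sum_abs _ _)
    _ ≤ ∑ i, ∑ j, |S i j| * (ξ ⬝ᵥ ξ) := by
        refine Finset.sum_le_sum fun i _ => Finset.sum_le_sum fun j _ => ?_
        rw [abs_mul, abs_mul, ← euclLen_sq]
        have := mul_le_mul (abs_apply_le_euclLen ξ i) (abs_apply_le_euclLen ξ j) (abs_nonneg _)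
          (euclLen_nonneg ξ)
        nlinarith [mul_le_mul_of_nonneg_left this (abs_nonneg (S i j))]
    _ = (∑ i, ∑ j, |S i j|) * (ξ ⬝ᵥ ξ) := by simp only [Finset.sum_mul]
    _ ≤ _ := mul_le_mul_of_nonneg_right hb (dotProduct_self_nonneg' ξ)

lemma ConcaveOn.le_of_radial {E : Type*} [NormedAddCommGroup E] [NormedSpace ℝ E] {g : E → ℝ}
    (hg : ConcaveOn ℝ Set.univ g) {p : E} (hd : DifferentiableAt ℝ g p) :
    g 0 ≤ g p - fderiv ℝ g p p := by
  have := ConcaveOn.le_tangent hg (Set.mem_univ p) (Set.mem_univ 0) hd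
  simpa [sub_eq_add_neg] using this

lemma ConcaveOn.le_norm_mul {E : Type*} [NormedAddCommGroup E] [NormedSpace ℝ E] {g : E → ℝ}
    (hg : ConcaveOn ℝ Set.univ g) {p : E} (hp : 1 ≤ ‖p‖) :
    g p ≤ ‖p‖ * g (‖p‖⁻¹ • p) - (‖p‖ - 1) * g 0 := by
  have hp0 : 0 < ‖p‖ := by linarith
  have := hg.2 (Set.mem_univ 0) (Set.mem_univ p) (sub_nonneg.2 (inv_le_one_of_one_le₀ hp))
    (inv_nonneg.2 hp0.le) (by ring)
  rw [smul_zero, zero_add, smul_eq_mul, smul_eq_mul] at this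
  have h2 := mul_le_mul_of_nonneg_left this hp0.le
  have h3 : ‖p‖ * ((1 - ‖p‖⁻¹) * g 0 + ‖p‖⁻¹ * g p) = (‖p‖ - 1) * g 0 + g p := by
    field_simp
  linarith

lemma exists_bound_on_compact {X : Type*} [TopologicalSpace X] {s : Set X} (hs : IsCompact s)
    {g : X → ℝ} (hg : Continuous g) : ∃ B, 0 ≤ B ∧ ∀ x ∈ s, |g x| ≤ B := by
  obtain ⟨B, hB⟩ := hs.exists_bound_of_continuousOn hg.continuousOn
  exact ⟨max B 0, le_max_right _ _, fun x hx => (hB x hx).trans (le_max_left _ _)⟩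

lemma one_add_rpow_le {a γ γ' : ℝ} (ha : 1 ≤ a) (hγ : γ ≤ γ') (hγ' : 0 ≤ γ') :
    1 + a ^ γ ≤ 2 * a ^ γ' := by
  have h1 := Real.rpow_le_rpow_of_exponent_le ha hγ
  have h2 := Real.one_le_rpow ha hγ'
  linarith

lemma exists_psi_bound {n : ℕ} {Ω : Set (Fin n → ℝ)} (hΩb : Bornology.IsBounded Ω) {T : ℝ}
    {ψ : (Fin n → ℝ) → ℝ → ℝ → (Fin n → ℝ) → ℝ} (hψ : PsiSmooth ψ)
    (hconc : ∀ x t z, ConcaveOn ℝ Set.univ fun p : Fin n → ℝ => -(ψ x t z p))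
    {ψb : (Fin n → ℝ) → ℝ → ℝ → ℝ}
    (hψbc : Continuous fun q : ((Fin n → ℝ) × ℝ) × ℝ => ψb q.1.1 q.1.2 q.2)
    {γ γ' M : ℝ} (hγγ' : γ ≤ γ') (hγ' : 0 ≤ γ')
    (hd : ∀ x ∈ closure Ω, ∀ t ∈ Set.Icc (0 : ℝ) T, ∀ (z : ℝ) (p : Fin n → ℝ),
      M ≤ ‖p‖ → fderiv ℝ (fun r => ψ x t z r) p p ≤ ψb x t z * (1 + ‖p‖ ^ γ))
    (hl : ∀ x ∈ closure Ω, ∀ t ∈ Set.Icc (0 : ℝ) T, ∀ (z : ℝ) (p : Fin n → ℝ),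
      M ≤ ‖p‖ → -(ψ x t z p) ≤ ψb x t z * (1 + ‖p‖ ^ γ)) (K : ℝ) :
    ∃ C, 0 ≤ C ∧ ∀ x ∈ closure Ω, ∀ t ∈ Set.Icc (0 : ℝ) T, ∀ z : ℝ, |z| ≤ K →
      ∀ p : Fin n → ℝ, M ≤ ‖p‖ → 1 ≤ ‖p‖ → |ψ x t z p| ≤ C * ‖p‖ ^ γ' := by
  have hcpt : IsCompact ((closure Ω ×ˢ Set.Icc (0 : ℝ) T) ×ˢ Set.Icc (-K) K) :=
    (hΩb.isCompact_closure.prod isCompact_Icc).prod isCompact_Icc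
  obtain ⟨B, hB0, hB⟩ := exists_bound_on_compact hcpt hψbc
  have hψ0 : Continuous fun q : ((Fin n → ℝ) × ℝ) × ℝ => ψ q.1.1 q.1.2 q.2 0 :=
    (ContDiff.continuous hψ).comp (f := fun q : ((Fin n → ℝ) × ℝ) × ℝ =>
      ((q.1, q.2, 0) : ((Fin n → ℝ) × ℝ) × ℝ × (Fin n → ℝ))) (by fun_prop)
  obtain ⟨B', hB'0, hB'⟩ := exists_bound_on_compact hcpt hψ0
  refine ⟨2 * B + B', by positivity, fun x hx t ht z hz p hpM hp1 => ?_⟩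
  have hmem : ((x, t), z) ∈ (closure Ω ×ˢ Set.Icc (0 : ℝ) T) ×ˢ Set.Icc (-K) K :=
    ⟨⟨hx, ht⟩, abs_le.1 hz⟩
  have hb := (le_abs_self _).trans (hB _ hmem)
  have hb' := (le_abs_self _).trans (hB' _ hmem)
  simp only at hb hb'
  have h1 := one_add_rpow_le hp1 hγγ' hγ'
  have h2 := Real.one_le_rpow hp1 hγ'
  have h3 : ψb x t z * (1 + ‖p‖ ^ γ) ≤ B * (2 * ‖p‖ ^ γ') :=
    (mul_le_mul_of_nonneg_right hb (by positivity)).trans (mul_le_mul_of_nonneg_left h1 hB0)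
  have hdiff : DifferentiableAt ℝ (fun r => ψ x t z r) p := by
    have : ContDiff ℝ (⊤ : ℕ∞) fun r => ψ x t z r :=
      ContDiff.comp (g := fun q : ((Fin n → ℝ) × ℝ) × ℝ × (Fin n → ℝ) =>
        ψ q.1.1 q.1.2 q.2.1 q.2.2) (f := fun r => ((x, t), z, r)) hψ
        (contDiff_const.prodMk (contDiff_const.prodMk contDiff_id))
    exact this.differentiable (by simp) p
  have h4 := ConcaveOn.le_of_radial (hconc x t z) hdiff.fun_neg
  rw [fderiv_fun_neg] at h4
  simp only [neg_apply] at h4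
  have h5 := hd x hx t ht z p hpM
  have h6 := hl x hx t ht z p hpM
  rw [abs_le]
  constructor <;> nlinarith [mul_le_mul_of_nonneg_left h2 hB'0]

open Matrix in
lemma exists_qform_bound {n : ℕ} {Ω : Set (Fin n → ℝ)} (hΩb : Bornology.IsBounded Ω) {T : ℝ}
    {A : (Fin n → ℝ) → ℝ → (Fin n → ℝ) → Mat n} (hA : ASmooth A)
    (hconc : ∀ x t (ξ : Fin n → ℝ), ConcaveOn ℝ Set.univ fun p => qform (A x t p) ξ)
    {ψb : (Fin n → ℝ) → ℝ → ℝ → ℝ}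
    (hψbc : Continuous fun q : ((Fin n → ℝ) × ℝ) × ℝ => ψb q.1.1 q.1.2 q.2)
    {γ γ' M : ℝ} (hγγ' : γ ≤ γ') (hγ' : 1 ≤ γ')
    (hd : ∀ x ∈ closure Ω, ∀ t ∈ Set.Icc (0 : ℝ) T, ∀ (z : ℝ) (p : Fin n → ℝ),
      M ≤ ‖p‖ → ∀ ξ : Fin n → ℝ, -(fderiv ℝ (fun r => qform (A x t r) ξ) p p)
            ≤ ψb x t z * ‖ξ‖ ^ 2 * (1 + ‖p‖ ^ γ)) :
    ∃ C, 0 ≤ C ∧ ∀ x ∈ closure Ω, ∀ t ∈ Set.Icc (0 : ℝ) T, ∀ p : Fin n → ℝ, M ≤ ‖p‖ → 1 ≤ ‖p‖ →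
      ∀ ξ : Fin n → ℝ, |qform (A x t p) ξ| ≤ C * ‖p‖ ^ γ' * (ξ ⬝ᵥ ξ) := by
  have hcpt : IsCompact (closure Ω ×ˢ Set.Icc (0 : ℝ) T) :=
    hΩb.isCompact_closure.prod isCompact_Icc
  obtain ⟨B, hB0, hB⟩ := exists_bound_on_compact hcpt
    (g := fun q : (Fin n → ℝ) × ℝ => ψb q.1 q.2 0)
    (hψbc.comp (f := fun q : (Fin n → ℝ) × ℝ => (q, (0 : ℝ))) (by fun_prop))
  obtain ⟨b, hb0, hb⟩ := exists_bound_on_compact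
    (hcpt.prod (isCompact_closedBall (0 : Fin n → ℝ) 1))
    (g := fun q : ((Fin n → ℝ) × ℝ) × (Fin n → ℝ) => ∑ i, ∑ j, |A q.1.1 q.1.2 q.2 i j|)
    (continuous_finsetSum _ fun i _ => continuous_finsetSum _ fun j _ =>
      (ContDiff.continuous (hA.2 i j)).abs)
  refine ⟨2 * B + 2 * b, by positivity, fun x hx t ht p hpM hp1 ξ => ?_⟩
  have hp0 : 0 < ‖p‖ := by linarith
  have hsmall : ∀ r : Fin n → ℝ, ‖r‖ ≤ 1 → |qform (A x t r) ξ| ≤ b * (ξ ⬝ᵥ ξ) := fun r hr =>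
    abs_qform_le ((le_abs_self _).trans (hb ((x, t), r) ⟨⟨hx, ht⟩, by simpa using hr⟩)) ξ
  have hz := abs_le.1 (hsmall 0 (by simp))
  have hu := abs_le.1 (hsmall (‖p‖⁻¹ • p) (by
    rw [norm_smul, norm_inv, norm_norm, inv_mul_cancel₀ hp0.ne']))
  have hψbB := (le_abs_self _).trans (hB (x, t) ⟨hx, ht⟩)
  simp only at hψbB
  have h1 := one_add_rpow_le hp1 hγγ' (by linarith)
  have h2 : ‖p‖ ≤ ‖p‖ ^ γ' := by
    simpa using Real.rpow_le_rpow_of_exponent_le hp1 hγ'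
  have hξ : ‖ξ‖ ^ 2 ≤ ξ ⬝ᵥ ξ := by
    rw [← euclLen_sq]
    exact pow_le_pow_left₀ (norm_nonneg _) (norm_le_euclLen ξ) 2
  have hξ0 := dotProduct_self_nonneg' ξ
  have h3 : ψb x t 0 * ‖ξ‖ ^ 2 * (1 + ‖p‖ ^ γ) ≤ B * (ξ ⬝ᵥ ξ) * (2 * ‖p‖ ^ γ') := by
    have e1 : ψb x t 0 * ‖ξ‖ ^ 2 ≤ B * (ξ ⬝ᵥ ξ) :=
      (mul_le_mul_of_nonneg_right hψbB (by positivity)).trans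
        (mul_le_mul_of_nonneg_left hξ hB0)
    exact (mul_le_mul_of_nonneg_right e1 (by positivity)).trans
      (mul_le_mul_of_nonneg_left h1 (mul_nonneg hB0 hξ0))
  have hdiff : DifferentiableAt ℝ (fun r => qform (A x t r) ξ) p := by
    have hij : ∀ i j, DifferentiableAt ℝ (fun r => A x t r i j) p := fun i j => by
      have : ContDiff ℝ (⊤ : ℕ∞) fun r => A x t r i j :=
        ContDiff.comp (g := fun q : ((Fin n → ℝ) × ℝ) × (Fin n → ℝ) => A q.1.1 q.1.2 q.2 i j)
          (f := fun r => ((x, t), r)) (hA.2 i j) (contDiff_const.prodMk contDiff_id)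
      exact this.differentiable (by simp) p
    unfold qform
    exact DifferentiableAt.fun_sum fun i _ => DifferentiableAt.fun_sum fun j _ =>
      ((hij i j).const_mul _).mul_const _
  have h4 := ConcaveOn.le_of_radial (hconc x t ξ) hdiff
  have h5 := hd x hx t ht 0 p hpM ξ
  have h6 := ConcaveOn.le_norm_mul (hconc x t ξ) hp1
  have hbξ : 0 ≤ b * (ξ ⬝ᵥ ξ) := mul_nonneg hb0 hξ0
  have h7 := mul_le_mul_of_nonneg_right h2 hbξ
  have h8 : 0 ≤ B * (ξ ⬝ᵥ ξ) * (‖p‖ ^ γ') :=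
    mul_nonneg (mul_nonneg hB0 hξ0) (by positivity)
  rw [abs_le]
  constructor
  · nlinarith [mul_le_mul_of_nonneg_left hp1 hbξ]
  · nlinarith [mul_le_mul_of_nonneg_left hu.2 hp0.le,
      mul_le_mul_of_nonneg_left hz.1 (sub_nonneg.2 hp1)]

open Matrix in
/-- In a smooth bounded domain, near points can be approached along uniformly transversal
directions pointing into the domain. -/
lemma exists_inward_direction {n : ℕ} {Ω : Set (Fin n → ℝ)} (hΩo : IsOpen Ω)
    (hΩb : Bornology.IsBounded Ω) (hΩs : SmoothBoundary Ω) :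
    ∃ δ > 0, ∀ x ∈ closure Ω, ∀ y ∈ closure Ω, x ≠ y → euclLen (x - y) ≤ δ →
      ∃ d : Fin n → ℝ, ‖d‖ ≤ 2 ∧ euclLen (x - y) / 2 ≤ d ⬝ᵥ (y - x) ∧
        ∀ᶠ s in 𝓝[>] (0 : ℝ), x + s • d ∈ Ω := by
  obtain ⟨ρ, hρ, hΩρ, hρ0⟩ := hΩs
  have hρd : Differentiable ℝ ρ := hρ.differentiable (by simp)
  have hρc : Continuous (fderiv ℝ ρ) := hρ.continuous_fderiv (by simp)
  have hgc : Continuous (sgrad ρ) := continuous_pi fun i => hρc.clm_apply continuous_const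
  have hfr : IsCompact (frontier Ω) :=
    hΩb.isCompact_closure.of_isClosed_subset isClosed_frontier frontier_subset_closure
  have hgne : ∀ x ∈ frontier Ω, 0 < euclLen (sgrad ρ x) := fun x hx => by
    refine euclLen_pos fun h => hρ0 x hx ?_
    ext ξ
    rw [fderiv_apply_eq_sgrad, h]
    simp
  obtain ⟨c₀, hc₀, hc₀le⟩ := hfr.exists_forall_le' (continuous_euclLen.comp hgc).continuousOn hgne
  obtain ⟨R₁, hR₁⟩ := hΩb.isCompact_closure.isBounded.subset_closedBall 0
  have huc := (isCompact_closedBall (0 : Fin n → ℝ) R₁).uniformContinuousOn_of_continuous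
    hρc.continuousOn
  obtain ⟨δ, hδ, hδuc⟩ := Metric.uniformContinuousOn_iff.1 huc (c₀ / 8) (by positivity)
  refine ⟨δ / 2, by positivity, fun x hx y hy hxy hxyδ => ?_⟩
  set r := euclLen (x - y) with hr
  have hr0 : 0 < r := euclLen_pos (sub_ne_zero.2 hxy)
  have hr' : euclLen (y - x) = r := euclLen_sub_comm y x
  have hdir : ‖r⁻¹ • (y - x)‖ ≤ 1 := by
    refine (norm_le_euclLen _).trans_eq ?_
    rw [euclLen_smul, hr', abs_of_pos (inv_pos.2 hr0), inv_mul_cancel₀ hr0.ne']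
  have hdot : (r⁻¹ • (y - x)) ⬝ᵥ (y - x) = r := by
    rw [smul_dotProduct, ← euclLen_sq, hr', smul_eq_mul, sq, inv_mul_cancel_left₀ hr0.ne']
  by_cases hxΩ : x ∈ Ω
  · refine ⟨r⁻¹ • (y - x), by linarith, by linarith, ?_⟩
    refine Filter.Eventually.filter_mono nhdsWithin_le_nhds ?_
    have hc : ContinuousAt (fun s : ℝ => x + s • (r⁻¹ • (y - x))) 0 := by fun_prop
    exact hc.eventually_mem (by simpa using hΩo.mem_nhds hxΩ)
  · have hxfr : x ∈ frontier Ω := by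
      rw [hΩo.frontier_eq]; exact ⟨hx, hxΩ⟩
    have hcl : ∀ z ∈ closure Ω, ρ z ≤ 0 := fun z hz => by
      have : closure Ω ⊆ {z | ρ z ≤ 0} := by
        refine closure_minimal ?_ (isClosed_le hρ.continuous continuous_const)
        rw [hΩρ]
        exact fun z (hz : ρ z < 0) => hz.le
      exact this hz
    have hρx : ρ x = 0 := by
      refine le_antisymm (hcl x hx) ?_
      rw [hΩρ] at hxΩ
      exact not_lt.1 hxΩ
    set g := sgrad ρ x
    set l := euclLen g
    have hl : c₀ ≤ l := hc₀le x hxfr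
    have hl0 : 0 < l := hc₀.trans_le hl
    have hsmall : g ⬝ᵥ (y - x) ≤ c₀ / 8 * r := by
      have hseg : segment ℝ x y ⊆ Metric.closedBall 0 R₁ :=
        (convex_closedBall 0 R₁).segment_subset (hR₁ hx) (hR₁ hy)
      have hnyx : ‖y - x‖ ≤ r := hr' ▸ norm_le_euclLen (y - x)
      have := Convex.norm_image_sub_le_of_norm_fderiv_le' (f := ρ) (φ := fderiv ℝ ρ x)
        (s := segment ℝ x y) (C := c₀ / 8) (fun z _ => hρd z) (fun z hz => by
          rw [← dist_eq_norm]
          refine (hδuc z (hseg hz) x (hR₁ hx) ?_).le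
          have : dist z x ≤ ‖y - x‖ := by
            rw [segment_eq_image'] at hz
            obtain ⟨θ, hθ, rfl⟩ := hz
            rw [dist_eq_norm, add_sub_cancel_left, norm_smul, Real.norm_of_nonneg hθ.1]
            exact mul_le_of_le_one_left (norm_nonneg _) hθ.2
          linarith)
        (convex_segment x y) (left_mem_segment ℝ x y) (right_mem_segment ℝ x y)
      rw [hρx, sub_zero, fderiv_apply_eq_sgrad, Real.norm_eq_abs] at this
      have h1 := (abs_le.1 this).1
      have h2 := hcl y hy
      nlinarith
    have hgl : ‖l⁻¹ • g‖ ≤ 1 := by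
      refine (norm_le_euclLen _).trans_eq ?_
      rw [euclLen_smul, abs_of_pos (inv_pos.2 hl0), inv_mul_cancel₀ hl0.ne']
    refine ⟨r⁻¹ • (y - x) - (1 / 4 : ℝ) • (l⁻¹ • g), ?_, ?_, ?_⟩
    · refine (norm_sub_le _ _).trans ?_
      rw [norm_smul (1 / 4 : ℝ)]
      norm_num
      linarith
    · rw [sub_dotProduct, hdot, smul_dotProduct, smul_dotProduct, smul_eq_mul, smul_eq_mul]
      have h1 := (le_abs_self _).trans (abs_dotProduct_le_euclLen g (y - x))
      rw [hr'] at h1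
      have h2 : l⁻¹ * (g ⬝ᵥ (y - x)) ≤ r := by
        rw [inv_mul_le_iff₀ hl0]; exact h1
      linarith
    · set d := r⁻¹ • (y - x) - (1 / 4 : ℝ) • (l⁻¹ • g)
      have hgd : g ⬝ᵥ d < 0 := by
        have e : g ⬝ᵥ d = r⁻¹ * (g ⬝ᵥ (y - x)) - 1 / 4 * l := by
          simp only [d, dotProduct_sub, dotProduct_smul, smul_eq_mul]
          rw [← euclLen_sq g]
          change _ - 1 / 4 * (l⁻¹ * l ^ 2) = _
          field_simp
        have h2 : r⁻¹ * (g ⬝ᵥ (y - x)) ≤ c₀ / 8 := by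
          rw [inv_mul_le_iff₀ hr0]; linarith
        rw [e]
        linarith
      have hder : HasDerivAt (fun s : ℝ => ρ (x + s • d)) (g ⬝ᵥ d) 0 := by
        have := hasDerivAt_comp_ray (contDiff_infty.1 hρ 2) x d 0
        simpa using this
      have h1 := hder.tendsto_slope_zero_right.eventually_lt_const hgd
      filter_upwards [h1, self_mem_nhdsWithin] with s hs hspos
      have hspos' : (0 : ℝ) < s := hspos
      rw [hΩρ]
      simp only [zero_add, zero_smul, add_zero, hρx, sub_zero, smul_eq_mul] at hs
      change ρ (x + s • d) < 0
      by_contra! h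
      exact absurd (mul_nonneg (inv_nonneg.2 hspos'.le) h) (not_le.2 hs)

open Matrix in
lemma profile_one_sided_derivative {n : ℕ} {w d : Fin n → ℝ} {N c r m : ℝ} (hw0 : w ≠ 0)
    (hr : r = euclLen w) (hc : 0 ≤ c) (hm : m = N - 3 / 2 * c * √r) (hm0 : 0 ≤ m)
    {g : ℝ → ℝ} {g' : ℝ} (hg : HasDerivAt g g' 0)
    (hle : ∀ᶠ s in 𝓝[>] (0 : ℝ), g s - profile N c (euclLen (w + s • d))
      ≤ g 0 - profile N c r) : g' ≤ m * ((w ⬝ᵥ d) / r) := by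
  have hr0 : 0 < r := hr ▸ euclLen_pos hw0
  refine deriv_le_of_eventually_le (b := m * ((d ⬝ᵥ d) / (2 * r))) hg ?_
  filter_upwards [hle] with s hs
  have h1 := profile_le_tangent (N := N) hc (euclLen_nonneg (w + s • d)) hr0
  have h2 := euclLen_add_le hw0 (s • d)
  rw [← hr] at h2
  simp only [dotProduct_smul, smul_dotProduct, smul_eq_mul] at h2
  rw [← hm] at h1
  have h3 : m * (euclLen (w + s • d) - r)
      ≤ m * (s * (w ⬝ᵥ d) / r + s * (s * (d ⬝ᵥ d)) / (2 * r)) :=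
    mul_le_mul_of_nonneg_left (by linarith) hm0
  have h4 : m * (s * (w ⬝ᵥ d) / r + s * (s * (d ⬝ᵥ d)) / (2 * r))
      = m * ((w ⬝ᵥ d) / r) * s + m * ((d ⬝ᵥ d) / (2 * r)) * s ^ 2 := by
    field_simp
  linarith

lemma profile_slope_bounds {N r₀ r : ℝ} (hN : 0 < N) (hr₀ : 0 < r₀) (hrr : r ≤ r₀) :
    N / 2 ≤ N - 3 / 2 * (N / (3 * √r₀)) * √r ∧ N - 3 / 2 * (N / (3 * √r₀)) * √r ≤ N := by
  have ha : 0 < √r₀ := Real.sqrt_pos.2 hr₀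
  have h1 : √r ≤ √r₀ := Real.sqrt_le_sqrt hrr
  have h2 : 3 / 2 * (N / (3 * √r₀)) * √r = N / 2 * (√r / √r₀) := by
    field_simp
  have h3 : √r / √r₀ ≤ 1 := (div_le_one ha).2 h1
  have h4 : 0 ≤ √r / √r₀ := by positivity
  rw [h2]
  constructor <;> nlinarith

lemma qform_add {n : ℕ} (S T : Mat n) (ξ : Fin n → ℝ) :
    qform (S + T) ξ = qform S ξ + qform T ξ := by
  simp only [qform_eq_dotProduct, Matrix.add_mulVec, dotProduct_add]

open Matrix in
/-- The gain of `f` between two points where `u(x) - u(y) - profile |x - y|` has a local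
maximum. -/
lemma gain_at_two_point_maximum {n : ℕ} {Γ : Set (Fin n → ℝ)} (hΓ : GoodCone Γ)
    {f : (Fin n → ℝ) → ℝ} (hfs : SmoothSymF Γ f) (hf1 : F1cond Γ f) (hf2 : F2cond Γ f)
    (hf4 : ∀ lam ∈ Γ, ∀ s : ℝ, 0 < s → f (s • lam) = s * f lam)
    {v : (Fin n → ℝ) → ℝ} (hv : ContDiff ℝ 2 v) {x y w : Fin n → ℝ} {N r₀ r C : ℝ}
    (hw : w = x - y) (hw0 : w ≠ 0) (hr : r = euclLen w) (hN : 0 < N) (hrr : r ≤ r₀)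
    (hmax : ∀ᶠ q in 𝓝 (x, y), v q.1 - v q.2 - profile N (N / (3 * √r₀)) (euclLen (q.1 - q.2))
      ≤ v x - v y - profile N (N / (3 * √r₀)) r)
    {P Q : Mat n} (hP : ∀ ξ, |qform P ξ| ≤ C * (ξ ⬝ᵥ ξ)) (hQ : ∀ ξ, |qform Q ξ| ≤ C * (ξ ⬝ᵥ ξ))
    (hPΓ : eigenVec (shess v x + P) ∈ Γ) (hQΓ : eigenVec (shess v y + Q) ∈ Γ)
    (hC : 0 ≤ C) (hCN : 2 * C ≤ N / (6 * r₀)) :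
    f (eigenVec (shess v x + P))
      + (∑ j, fLam f (eigenVec (shess v y + Q)) j) * (N / (2304 * r₀) / n - 2 * C)
      ≤ f (eigenVec (shess v y + Q)) := by
  have hr0 : 0 < r := hr ▸ euclLen_pos hw0
  have hr₀ : 0 < r₀ := hr0.trans_le hrr
  have ha : 0 < √r₀ := Real.sqrt_pos.2 hr₀
  have hb : 0 < √r := Real.sqrt_pos.2 hr0
  have hba : √r ≤ √r₀ := Real.sqrt_le_sqrt hrr
  obtain ⟨hm1, hm2⟩ := profile_slope_bounds hN hr₀ hrr
  obtain ⟨-, -, hess, hesse⟩ := two_point_maximum hv hw hw0 hr (by positivity) rfl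
    (by linarith) hmax
  set m := N - 3 / 2 * (N / (3 * √r₀)) * √r
  have hκ : N / (3 * √r₀) / (2 * √r) = N / (6 * (√r₀ * √r)) := by
    field_simp
    norm_num
  rw [hκ] at hesse
  have hκge : N / (6 * r₀) ≤ N / (6 * (√r₀ * √r)) := by
    refine div_le_div_of_nonneg_left hN.le (by positivity) ?_
    nlinarith [Real.mul_self_sqrt hr₀.le]
  have he : (r⁻¹ • w) ⬝ᵥ (r⁻¹ • w) = 1 := by
    rw [← euclLen_sq, euclLen_smul, ← hr, abs_of_pos (inv_pos.2 hr0), inv_mul_cancel₀ hr0.ne',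
      one_pow]
  refine f_gain_of_two_point hΓ hfs hf1 hf2 hf4 (isHermitian_of_eigenVec_mem hΓ hPΓ)
    (isHermitian_of_eigenVec_mem hΓ hQΓ) hPΓ hQΓ (κ := N / (6 * (√r₀ * √r))) (ζ := m / r)
    (by positivity) (by positivity) hC ?_ ?_ he ?_ fun ξ η => ?_
  · refine le_trans ?_ hκge
    calc 8 * (N / (2304 * r₀)) = N / (288 * r₀) := by
          field_simp
          norm_num
      _ ≤ _ := div_le_div_of_nonneg_left hN.le (by positivity) (by linarith)
  · have e1 : (N / (6 * (√r₀ * √r))) ^ 2 = N * N / (36 * r₀ * r) := by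
      rw [div_pow, mul_pow, mul_pow, Real.sq_sqrt hr₀.le, Real.sq_sqrt hr0.le]
      ring
    have e2 : 64 * (N / (2304 * r₀)) * (m / r) = N * m / (36 * r₀ * r) := by
      field_simp
      ring
    rw [e1, e2]
    gcongr
  · rw [qform_add]
    have := (abs_le.1 (hP (r⁻¹ • w))).2
    rw [he] at this
    linarith
  · rw [qform_add, qform_add]
    have h1 := (abs_le.1 (hP ξ)).2
    have h2 := (abs_le.1 (hQ η)).1
    linarith [hess ξ η]

open Matrix in
/-- The two-point gradient estimate: differences of `u(·,t)` are controlled by the profile. -/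
lemma two_point_estimate {n : ℕ} {Ω : Set (Fin n → ℝ)} (hΩo : IsOpen Ω)
    (hΩb : Bornology.IsBounded Ω) {T : ℝ}
    {Γ : Set (Fin n → ℝ)} (hΓ : GoodCone Γ)
    {f : (Fin n → ℝ) → ℝ} (hfs : SmoothSymF Γ f) (hf1 : F1cond Γ f) (hf2 : F2cond Γ f)
    (hf4 : ∀ lam ∈ Γ, ∀ s : ℝ, 0 < s → f (s • lam) = s * f lam)
    {A : (Fin n → ℝ) → ℝ → (Fin n → ℝ) → Mat n}
    {ψ : (Fin n → ℝ) → ℝ → ℝ → (Fin n → ℝ) → ℝ}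
    {u : (Fin n → ℝ) → ℝ → ℝ} (hu : RegN 3 u) (hadm : Admissible Γ A u (QTbar Ω T))
    (hsol : SolvesE f A ψ u (QT Ω T)) {K N r₀ C R cf δ : ℝ} (hK : 0 < K)
    (huK : ∀ q ∈ QTbar Ω T, |u q.1 q.2| ≤ K) (hN : 0 < N) (hr₀ : r₀ = 4 * K / N)
    (hin : ∀ x ∈ closure Ω, ∀ y ∈ closure Ω, x ≠ y → euclLen (x - y) ≤ δ →
      ∃ d : Fin n → ℝ, ‖d‖ ≤ 2 ∧ euclLen (x - y) / 2 ≤ d ⬝ᵥ (y - x) ∧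
        ∀ᶠ s in 𝓝[>] (0 : ℝ), x + s • d ∈ Ω) (hδ : r₀ ≤ δ)
    (hR : ∀ q ∈ PQ Ω T, ‖sgrad (fun y => u y q.2) q.1‖ ≤ R) (hRN : 8 * n * R < N)
    (hψC : ∀ x ∈ closure Ω, ∀ t ∈ Set.Icc (0 : ℝ) T, ∀ z : ℝ, |z| ≤ K → ∀ p : Fin n → ℝ,
      N / 2 ≤ n * ‖p‖ → ‖p‖ ≤ N → |ψ x t z p| ≤ C)
    (hAC : ∀ x ∈ closure Ω, ∀ t ∈ Set.Icc (0 : ℝ) T, ∀ p : Fin n → ℝ,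
      N / 2 ≤ n * ‖p‖ → ‖p‖ ≤ N → ∀ ξ : Fin n → ℝ, |qform (A x t p) ξ| ≤ C * (ξ ⬝ᵥ ξ))
    (hCN : 2 * C ≤ N / (6 * r₀)) (hcf : ∀ μ ∈ Γ, cf ≤ ∑ j, fLam f μ j) (hcf0 : 0 < cf)
    (hgain : 2 * C < cf * (N / (2304 * r₀) / n - 2 * C)) :
    ∀ x ∈ closure Ω, ∀ y ∈ closure Ω, ∀ t ∈ Set.Icc (0 : ℝ) T, euclLen (x - y) ≤ r₀ →
      u x t - u y t ≤ profile N (N / (3 * √r₀)) (euclLen (x - y)) := by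
  have hr₀0 : 0 < r₀ := by rw [hr₀]; positivity
  have hNr : N * r₀ = 4 * K := by rw [hr₀]; field_simp
  have ha : 0 < √r₀ := Real.sqrt_pos.2 hr₀0
  set c := N / (3 * √r₀) with hc
  have hc0 : 0 ≤ c := by positivity
  have huc : Continuous fun q : (Fin n → ℝ) × ℝ => u q.1 q.2 := ContDiff.continuous hu
  let W : ((Fin n → ℝ) × (Fin n → ℝ)) × ℝ → ℝ := fun q =>
    u q.1.1 q.2 - u q.1.2 q.2 - profile N c (euclLen (q.1.1 - q.1.2))
  have hWc : Continuous W := by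
    have h1 : Continuous fun q : ((Fin n → ℝ) × (Fin n → ℝ)) × ℝ => u q.1.1 q.2 :=
      huc.comp (f := fun q : ((Fin n → ℝ) × (Fin n → ℝ)) × ℝ => (q.1.1, q.2)) (by fun_prop)
    have h2 : Continuous fun q : ((Fin n → ℝ) × (Fin n → ℝ)) × ℝ => u q.1.2 q.2 :=
      huc.comp (f := fun q : ((Fin n → ℝ) × (Fin n → ℝ)) × ℝ => (q.1.2, q.2)) (by fun_prop)
    fun_prop
  let E : Set (((Fin n → ℝ) × (Fin n → ℝ)) × ℝ) :=
    ((closure Ω ×ˢ closure Ω) ×ˢ Set.Icc 0 T) ∩ {q | euclLen (q.1.1 - q.1.2) ≤ r₀}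
  have hE : IsCompact E :=
    ((hΩb.isCompact_closure.prod hΩb.isCompact_closure).prod isCompact_Icc).inter_right
      (isClosed_le (by fun_prop) continuous_const)
  intro x₁ hx₁ y₁ hy₁ t₁ ht₁ hxy₁
  by_contra! hcon
  have hmem₁ : ((x₁, y₁), t₁) ∈ E := ⟨⟨⟨hx₁, hy₁⟩, ht₁⟩, hxy₁⟩
  obtain ⟨⟨⟨x, y⟩, t⟩, ⟨⟨⟨hx, hy⟩, ht⟩, hxyr⟩, hmax⟩ :=
    hE.exists_isMaxOn ⟨_, hmem₁⟩ hWc.continuousOn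
  have hWpos : 0 < W ((x, y), t) := lt_of_lt_of_le (sub_pos.2 hcon) (hmax hmem₁)
  change x ∈ closure Ω at hx
  change y ∈ closure Ω at hy
  change t ∈ Set.Icc 0 T at ht
  change euclLen (x - y) ≤ r₀ at hxyr
  have hmax' : ∀ x' ∈ closure Ω, ∀ y' ∈ closure Ω, ∀ t' ∈ Set.Icc (0 : ℝ) T,
      euclLen (x' - y') ≤ r₀ → u x' t' - u y' t' - profile N c (euclLen (x' - y'))
        ≤ u x t - u y t - profile N c (euclLen (x - y)) :=
    fun x' hx' y' hy' t' ht' h => hmax (a := ((x', y'), t')) ⟨⟨⟨hx', hy'⟩, ht'⟩, h⟩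
  simp only [W] at hWpos
  have hxy : x ≠ y := by
    rintro rfl
    simp at hWpos
  have hw0 : x - y ≠ 0 := sub_ne_zero.2 hxy
  set w := x - y with hw
  set r := euclLen w with hr
  have hr0 : 0 < r := euclLen_pos hw0
  have hux := abs_le.1 (huK (x, t) ⟨hx, ht⟩)
  have huy := abs_le.1 (huK (y, t) ⟨hy, ht⟩)
  have hrlt : r < r₀ := by
    refine hxyr.lt_of_ne fun h => ?_
    have h1 : profile N c r = 8 / 3 * K := by
      have : c * (r₀ * √r₀) = N * r₀ / 3 := by rw [hc]; field_simp
      rw [profile, h, this, hNr]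
      ring
    rw [h1] at hWpos
    simp only at hux huy
    linarith
  obtain ⟨hm1, hm2⟩ := profile_slope_bounds hN hr₀0 hxyr
  rw [← hc] at hm1 hm2
  set m := N - 3 / 2 * c * √r with hm
  have hm0 : 0 < m := by linarith
  have hv : ContDiff ℝ 2 fun y => u y t := (hu.contDiff_space t).of_le (by norm_num)
  have hnear : ∀ w' d : Fin n → ℝ, euclLen w' < r₀ →
      ∀ᶠ s in 𝓝[>] (0 : ℝ), euclLen (w' + s • d) ≤ r₀ := by
    intro w' d hw'
    refine Filter.Eventually.filter_mono nhdsWithin_le_nhds ?_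
    have hcont : ContinuousAt (fun s : ℝ => euclLen (w' + s • d)) 0 := by fun_prop
    refine (hcont.eventually_lt_const (by simpa using hw')).mono fun s hs => hs.le
  have hslope : ∀ z ∈ PQ Ω T, ∀ d : Fin n → ℝ, ‖d‖ ≤ 2 →
      |sgrad (fun y => u y z.2) z.1 ⬝ᵥ d| < N / 4 := by
    intro z hz d hd
    have h1 := abs_dotProduct_le (sgrad (fun y => u y z.2) z.1) d
    have h2 := hR z hz
    have h3 : n * ‖sgrad (fun y => u y z.2) z.1‖ * ‖d‖ ≤ n * R * 2 :=
      mul_le_mul (mul_le_mul_of_nonneg_left h2 (Nat.cast_nonneg n)) hd (norm_nonneg _)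
        (mul_nonneg (Nat.cast_nonneg n) ((norm_nonneg _).trans h2))
    linarith
  have hxP : (x, t) ∉ PQ Ω T := by
    intro hxP
    obtain ⟨d, hd2, hdw, hdΩ⟩ := hin x hx y hy hxy (hxyr.trans hδ)
    have hder : HasDerivAt (fun s : ℝ => u (x + s • d) t) (sgrad (fun y => u y t) x ⬝ᵥ d) 0 := by
      simpa using hasDerivAt_comp_ray hv x d 0
    have h1 := profile_one_sided_derivative (d := d) hw0 hr hc0 hm hm0.le hder (by
      filter_upwards [hdΩ, hnear w d hrlt] with s hs hs'
      have e : x + s • d - y = w + s • d := by rw [hw]; module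
      have := hmax' (x + s • d) (subset_closure hs) y hy t ht (by rw [e]; exact hs')
      rw [e] at this
      simp only [zero_smul, add_zero]
      linarith)
    have h2 : w ⬝ᵥ d / r ≤ -(1 / 2) := by
      rw [div_le_iff₀ hr0, dotProduct_comm]
      have : d ⬝ᵥ (y - x) = -(d ⬝ᵥ w) := by rw [hw, ← dotProduct_neg, neg_sub]
      linarith
    have h3 := (abs_lt.1 (hslope (x, t) hxP d hd2)).1
    simp only at h3
    nlinarith
  have hyP : (y, t) ∉ PQ Ω T := by
    intro hyP
    obtain ⟨d, hd2, hdw, hdΩ⟩ := hin y hy x hx hxy.symm (by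
      rw [euclLen_sub_comm]; exact hxyr.trans hδ)
    have hder : HasDerivAt (fun s : ℝ => -u (y + s • d) t)
        (-(sgrad (fun y => u y t) y ⬝ᵥ d)) 0 := by
      simpa using (hasDerivAt_comp_ray hv y d 0).fun_neg
    have hyx0 : y - x ≠ 0 := sub_ne_zero.2 hxy.symm
    have hryx : r = euclLen (y - x) := by rw [hr, hw, euclLen_sub_comm]
    have h1 := profile_one_sided_derivative (d := d) hyx0 hryx hc0 hm hm0.le hder (by
      filter_upwards [hdΩ, hnear (y - x) d (hryx ▸ hrlt)] with s hs hs'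
      have e : euclLen (x - (y + s • d)) = euclLen (y - x + s • d) := by
        rw [euclLen_sub_comm]
        congr 1
        module
      have := hmax' x hx (y + s • d) (subset_closure hs) t ht (by rw [e]; exact hs')
      rw [e] at this
      simp only [zero_smul, add_zero]
      linarith)
    have h2 : (y - x) ⬝ᵥ d / r ≤ -(1 / 2) := by
      rw [div_le_iff₀ hr0, dotProduct_comm]
      have : d ⬝ᵥ (x - y) = -(d ⬝ᵥ (y - x)) := by rw [← dotProduct_neg, neg_sub]
      rw [← hryx] at hdw
      linarith
    have h3 := (abs_lt.1 (hslope (y, t) hyP d hd2)).2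
    simp only at h3
    nlinarith
  have ht0 : t ∈ Set.Ioc 0 T := by
    refine ⟨ht.1.lt_of_ne fun h => hxP (Or.inl ⟨hx, ?_⟩), ht.2⟩
    exact h.symm
  have hinterior : ∀ z ∈ closure Ω, (z, t) ∉ PQ Ω T → z ∈ Ω := by
    intro z hz hzP
    by_contra hzΩ
    exact hzP (Or.inr ⟨by rw [hΩo.frontier_eq]; exact ⟨hz, hzΩ⟩, ht⟩)
  have hxΩ := hinterior x hx hxP
  have hyΩ := hinterior y hy hyP
  have hlocal : ∀ᶠ q in 𝓝 (x, y), u q.1 t - u q.2 t - profile N c (euclLen (q.1 - q.2))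
      ≤ u x t - u y t - profile N c r := by
    have h1 : ∀ᶠ q : (Fin n → ℝ) × (Fin n → ℝ) in 𝓝 (x, y), q ∈ Ω ×ˢ Ω :=
      (hΩo.prod hΩo).mem_nhds ⟨hxΩ, hyΩ⟩
    have hcont : Continuous fun q : (Fin n → ℝ) × (Fin n → ℝ) => euclLen (q.1 - q.2) := by fun_prop
    filter_upwards [h1, (hcont.tendsto (x, y)).eventually_lt_const hrlt] with q hq hq'
    exact hmax' q.1 (subset_closure hq.1) q.2 (subset_closure hq.2) t ht hq'.le
  obtain ⟨hgx, hgy, -, -⟩ := two_point_maximum hv hw hw0 hr hc0 hm hm0.le hlocal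
  have htime : deriv (u y) t ≤ deriv (u x) t := by
    have hd : ∀ z, HasDerivAt (fun s : ℝ => u z (t - s)) (-deriv (u z) t) 0 := fun z => by
      have h1 : HasDerivAt (u z) (deriv (u z) t) (t - 0) := by
        rw [sub_zero]
        exact ((hu.contDiff_time z).differentiable (by norm_num) t).hasDerivAt
      exact h1.comp_const_sub t 0
    have := deriv_le_of_eventually_le (a := 0) (b := 0) ((hd x).sub (hd y)) (by
      filter_upwards [Ioo_mem_nhdsGT ht0.1] with s hs
      have := hmax' x hx y hy (t - s) ⟨by linarith [hs.2], by linarith [hs.1, ht0.2]⟩ hxyr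
      simp only [Pi.sub_apply, sub_zero]
      linarith)
    linarith
  set p := (m / r) • w with hp
  have hplen : euclLen p = m := by
    rw [hp, euclLen_smul, ← hr, abs_of_pos (by positivity)]
    field_simp
  have hpn : N / 2 ≤ n * ‖p‖ := (hplen ▸ hm1).trans (euclLen_le p)
  have hpN : ‖p‖ ≤ N := (norm_le_euclLen p).trans (hplen ▸ hm2)
  have hUx : Umat A u x t = shess (fun y => u y t) x + A x t p := by rw [Umat, hgx]
  have hUy : Umat A u y t = shess (fun y => u y t) y + A y t p := by rw [Umat, hgy]
  have hadx := hadm (x, t) ⟨hx, ht⟩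
  have hady := hadm (y, t) ⟨hy, ht⟩
  have hsx := hsol (x, t) ⟨hxΩ, ht0⟩
  have hsy := hsol (y, t) ⟨hyΩ, ht0⟩
  simp only [hgx, hgy, hUx, hUy] at hadx hady hsx hsy
  have hψx := hψC x hx t ht (u x t) (huK (x, t) ⟨hx, ht⟩) p hpn hpN
  have hψy := hψC y hy t ht (u y t) (huK (y, t) ⟨hy, ht⟩) p hpn hpN
  have hC0 : 0 ≤ C := (abs_nonneg _).trans hψx
  have hgain' := gain_at_two_point_maximum hΓ hfs hf1 hf2 hf4 hv hw hw0 hr hN hxyr hlocal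
    (hAC x hx t ht p hpn hpN) (hAC y hy t ht p hpn hpN) hadx hady hC0 hCN
  have hsum := hcf _ hady
  have hpos : 0 < N / (2304 * r₀) / n - 2 * C := by
    by_contra! h
    nlinarith
  have := mul_le_mul_of_nonneg_right hsum hpos.le
  linarith [(abs_le.1 hψx).1, (abs_le.1 hψy).2]

lemma norm_sgrad_le_of_local {n : ℕ} {v : (Fin n → ℝ) → ℝ} (hv : ContDiff ℝ 2 v)
    {x : Fin n → ℝ} {N : ℝ} (hN : 0 ≤ N) (h : ∀ᶠ y in 𝓝 x, v x - v y ≤ N * euclLen (x - y)) :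
    ‖sgrad v x‖ ≤ N := by
  have hdir : ∀ d : Fin n → ℝ, -(dotProduct (sgrad v x) d) ≤ N * euclLen d := by
    intro d
    have hder : HasDerivAt (fun s : ℝ => -v (x + s • d)) (-(dotProduct (sgrad v x) d)) 0 := by
      simpa using (hasDerivAt_comp_ray hv x d 0).fun_neg
    refine deriv_le_of_eventually_le (b := 0) hder ?_
    have hcont : Filter.Tendsto (fun s : ℝ => x + s • d) (𝓝 0) (𝓝 x) :=
      Continuous.tendsto' (by fun_prop) _ _ (by simp)
    have hev : ∀ᶠ s in 𝓝 (0 : ℝ), v x - v (x + s • d) ≤ N * euclLen (x - (x + s • d)) :=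
      hcont.eventually h
    filter_upwards [nhdsWithin_le_nhds hev, self_mem_nhdsWithin] with s hs hpos
    have hpos' : (0 : ℝ) < s := hpos
    have e : euclLen (x - (x + s • d)) = s * euclLen d := by
      rw [euclLen_sub_comm, add_sub_cancel_left, euclLen_smul, abs_of_pos hpos']
    rw [e] at hs
    simp only [zero_smul, add_zero]
    linarith
  refine (pi_norm_le_iff_of_nonneg hN).2 fun i => ?_
  have he : euclLen (Pi.single i 1 : Fin n → ℝ) = 1 := by simp [euclLen]
  have h1 := hdir (Pi.single i 1)
  have h2 := hdir (-Pi.single i 1)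
  rw [euclLen_neg] at h2
  rw [he] at h1 h2
  simp only [dotProduct_neg, dotProduct_single, mul_one, neg_neg] at h1 h2
  exact abs_le.2 ⟨by linarith, h2⟩

lemma eventually_mul_rpow_lt_mul_sq {γ D a : ℝ} (hγ : γ < 2) (ha : 0 < a) :
    ∀ᶠ N : ℝ in Filter.atTop, D * N ^ γ < a * N ^ 2 := by
  have h1 : Filter.Tendsto (fun N : ℝ => D * N ^ (-(2 - γ))) Filter.atTop (𝓝 (D * 0)) :=
    (tendsto_rpow_neg_atTop (by linarith)).const_mul D
  rw [mul_zero] at h1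
  filter_upwards [h1.eventually_lt_const ha, Filter.eventually_gt_atTop 0] with N hN hpos
  have e : N ^ γ = N ^ (-(2 - γ)) * N ^ 2 := by
    rw [← Real.rpow_natCast N 2, ← Real.rpow_add hpos]
    congr 1
    push_cast
    ring
  rw [e, ← mul_assoc]
  exact mul_lt_mul_of_pos_right hN (by positivity)

/-- Theorem 5.3 of the paper, flat case: gradient estimate
under (f4), (f6), (p-A5), (p-A500), (p-G20**) and (A1) with `γ₁, γ₂ < 4`. -/
theorem statement6
    {n : ℕ} (hn : 2 ≤ n)
    (Ω : Set (Fin n → ℝ)) (hΩo : IsOpen Ω) (hΩb : Bornology.IsBounded Ω)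
    (hΩs : SmoothBoundary Ω)
    (T : ℝ) (hT : 0 < T)
    (Γ : Set (Fin n → ℝ)) (hΓ : GoodCone Γ)
    (f : (Fin n → ℝ) → ℝ) (hfs : SmoothSymF Γ f) (hf1 : F1cond Γ f) (hf2 : F2cond Γ f)
    (A : (Fin n → ℝ) → ℝ → (Fin n → ℝ) → Mat n) (hA : ASmooth A)
    (ψ : (Fin n → ℝ) → ℝ → ℝ → (Fin n → ℝ) → ℝ) (hψ : PsiSmooth ψ)
    (hA2 : A2cond A ψ)
    -- (A1) with `γ₁, γ₂ < 4`
    (ψb1 : (Fin n → ℝ) → ℝ → ℝ)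
    (hψb1c : Continuous fun q : (Fin n → ℝ) × ℝ => ψb1 q.1 q.2)
    (hψb1nn : ∀ x t, 0 ≤ ψb1 x t)
    (ψb2 : (Fin n → ℝ) → ℝ → ℝ → ℝ)
    (hψb2c : Continuous fun q : ((Fin n → ℝ) × ℝ) × ℝ => ψb2 q.1.1 q.1.2 q.2)
    (hψb2nn : ∀ x t z, 0 ≤ ψb2 x t z)
    (γ₁ γ₂ : ℝ) (hγ₁ : 0 < γ₁ ∧ γ₁ < 4) (hγ₂ : 0 < γ₂ ∧ γ₂ < 4)
    (hA1a : A1a A ψb1 γ₁ Ω T) (hA1b : A1b ψ ψb2 γ₂ Ω T)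
    -- (f4): `f` is positively homogeneous of degree one on `Γ`
    (hf4 : ∀ lam ∈ Γ, ∀ s : ℝ, 0 < s → f (s • lam) = s * f lam)
    -- (f6)
    (ν₁ : ℝ) (hν₁ : 0 < ν₁)
    (hf6 : ∀ lam ∈ Γ, ∀ j, lam j < 0 →
      ν₁ * (1 + ∑ i, fLam f lam i) ≤ fLam f lam j)
    -- (p-A5), (p-A500), (p-G20**) for `|p|` large
    (ψb : (Fin n → ℝ) → ℝ → ℝ → ℝ)
    (hψbc : Continuous fun q : ((Fin n → ℝ) × ℝ) × ℝ => ψb q.1.1 q.1.2 q.2)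
    (hψbnn : ∀ x t z, 0 ≤ ψb x t z)
    (γ : ℝ) (hγ : 0 < γ ∧ γ < 2) (M : ℝ)
    (hpA5 : ∀ x ∈ closure Ω, ∀ t ∈ Set.Icc (0 : ℝ) T, ∀ (z : ℝ) (p : Fin n → ℝ),
      M ≤ ‖p‖ →
      fderiv ℝ (fun r => ψ x t z r) p p ≤ ψb x t z * (1 + ‖p‖ ^ γ) ∧
        ∀ ξ : Fin n → ℝ,
          -(fderiv ℝ (fun r => qform (A x t r) ξ) p p)
            ≤ ψb x t z * ‖ξ‖ ^ 2 * (1 + ‖p‖ ^ γ))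
    (hpA500 : ∀ x ∈ closure Ω, ∀ t ∈ Set.Icc (0 : ℝ) T, ∀ (z : ℝ) (p : Fin n → ℝ),
      M ≤ ‖p‖ → -(ψ x t z p) ≤ ψb x t z * (1 + ‖p‖ ^ γ))
    (hpG20 : ∀ x ∈ closure Ω, ∀ t ∈ Set.Icc (0 : ℝ) T, ∀ (z : ℝ) (p : Fin n → ℝ),
      M ≤ ‖p‖ → ∀ ξ η : Fin n → ℝ, (∑ i, ξ i * η i) = 0 →
        |∑ i, ∑ j, ξ i * A x t p i j * η j|
          ≤ ψb x t z * ‖ξ‖ * ‖η‖ * (1 + ‖p‖ ^ γ)) :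
    ∀ K > 0, ∃ C₃ > 0, ∀ u : (Fin n → ℝ) → ℝ → ℝ,
      RegN 3 u → Admissible Γ A u (QTbar Ω T) → SolvesE f A ψ u (QT Ω T) →
      (∀ q ∈ QTbar Ω T, |u q.1 q.2| ≤ K) →
      ∀ R : ℝ, (∀ q ∈ PQ Ω T, ‖sgrad (fun y => u y q.2) q.1‖ ≤ R) →
        ∀ q ∈ QTbar Ω T, ‖sgrad (fun y => u y q.2) q.1‖ ≤ C₃ * (1 + R) := by

  intro K hK
  have hn0 : (0 : ℝ) < n := by exact_mod_cast (by omega : 0 < n)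
  obtain ⟨δ, hδ, hin⟩ := exists_inward_direction hΩo hΩb hΩs
  obtain ⟨cf, hcf0, hcf⟩ := exists_le_sum_fLam hn hΓ hfs hf1 hf2 hf4
  set γ' := max γ 1
  have hγ'2 : γ' < 2 := max_lt hγ.2 one_lt_two
  have hγ'1 : 1 ≤ γ' := le_max_right _ _
  obtain ⟨C₁, hC₁, hψC⟩ := exists_psi_bound hΩb hψ hA2.1 hψbc (le_max_left γ 1)
    (zero_le_one.trans hγ'1) (fun x hx t ht z p hp => (hpA5 x hx t ht z p hp).1) hpA500 K
  obtain ⟨C₂, hC₂, hAC⟩ := exists_qform_bound hΩb hA hA2.2 hψbc (le_max_left γ 1) hγ'1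
    (fun x hx t ht z p hp => (hpA5 x hx t ht z p hp).2)
  set C₀ := C₁ + C₂
  have hev : ∀ᶠ N : ℝ in Filter.atTop, 1 ≤ N ∧ 2 * n * max M 1 ≤ N ∧ 4 * K / δ ≤ N ∧
      2 * C₀ * N ^ γ' < 1 / (24 * K) * N ^ 2 ∧
      (2 * C₀ + 2 * cf * C₀) * N ^ γ' < cf / (9216 * K * n) * N ^ 2 := by
    filter_upwards [Filter.eventually_ge_atTop 1, Filter.eventually_ge_atTop (2 * n * max M 1),
      Filter.eventually_ge_atTop (4 * K / δ),
      eventually_mul_rpow_lt_mul_sq (D := 2 * C₀) hγ'2 (by positivity : 0 < 1 / (24 * K)),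
      eventually_mul_rpow_lt_mul_sq (D := 2 * C₀ + 2 * cf * C₀) hγ'2
        (by positivity : 0 < cf / (9216 * K * n))] with N h1 h2 h3 h4 h5
    exact ⟨h1, h2, h3, h4, h5⟩
  obtain ⟨N₀, hN₀⟩ := Filter.eventually_atTop.1 hev
  have hC₃ : 8 * (n : ℝ) + 1 ≤ max N₀ (8 * n + 1) := le_max_right _ _
  refine ⟨max N₀ (8 * n + 1), by linarith, fun u hu hadm hsol huK R hR q hq => ?_⟩
  have hR0 : 0 ≤ R := (norm_nonneg _).trans (hR (q.1, 0) (Or.inl ⟨hq.1, rfl⟩))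
  by_cases hqP : q ∈ PQ Ω T
  · refine (hR q hqP).trans ?_
    nlinarith
  set N := max N₀ (8 * n + 1) * (1 + R) with hNdef
  have hNN₀ : N₀ ≤ N := by
    refine (le_max_left N₀ (8 * n + 1)).trans ?_
    rw [hNdef]
    exact le_mul_of_one_le_right (by linarith) (by linarith)
  have hRN : 8 * n * R < N := by
    rw [hNdef]
    nlinarith [mul_le_mul_of_nonneg_right hC₃ (by linarith : 0 ≤ 1 + R)]
  obtain ⟨hN1, hNM, hNδ, hNC, hNgain⟩ := hN₀ N hNN₀
  have hNpos : 0 < N := by linarith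
  have hp : ∀ p : Fin n → ℝ, N / 2 ≤ n * ‖p‖ → ‖p‖ ≤ N →
      M ≤ ‖p‖ ∧ 1 ≤ ‖p‖ ∧ ‖p‖ ^ γ' ≤ N ^ γ' := by
    intro p h1 h2
    have h3 : max M 1 ≤ ‖p‖ := by
      by_contra! h
      nlinarith
    exact ⟨(le_max_left _ _).trans h3, (le_max_right _ _).trans h3,
      Real.rpow_le_rpow (norm_nonneg _) h2 (by linarith)⟩
  have hNr : N / (4 * K / N) = N ^ 2 / (4 * K) := by field_simp
  have hest := two_point_estimate (N := N) (C := C₀ * N ^ γ') hΩo hΩb hΓ hfs hf1 hf2 hf4 hu hadm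
    hsol hK huK hNpos rfl hin ((div_le_comm₀ hδ hNpos).1 hNδ) hR hRN
    (fun x hx t ht z hz p h1 h2 => by
      obtain ⟨h3, h4, h5⟩ := hp p h1 h2
      refine (hψC x hx t ht z hz p h3 h4).trans ?_
      exact mul_le_mul (le_add_of_nonneg_right hC₂) h5 (by positivity) (by positivity))
    (fun x hx t ht p h1 h2 ξ => by
      obtain ⟨h3, h4, h5⟩ := hp p h1 h2
      refine (hAC x hx t ht p h3 h4 ξ).trans ?_
      refine mul_le_mul_of_nonneg_right ?_ (dotProduct_self_nonneg' ξ)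
      exact mul_le_mul (le_add_of_nonneg_left hC₁) h5 (by positivity) (by positivity))
    (by
      have e : N / (6 * (4 * K / N)) = 1 / (24 * K) * N ^ 2 := by
        field_simp
        norm_num
      rw [e]
      linarith)
    hcf hcf0 (by
      have e : cf * (N / (2304 * (4 * K / N)) / n) = cf / (9216 * K * n) * N ^ 2 := by
        field_simp
        norm_num
      rw [mul_sub, e]
      linarith)
  have hxΩ : q.1 ∈ Ω := by
    by_contra hx
    exact hqP (Or.inr ⟨by rw [hΩo.frontier_eq]; exact ⟨hq.1, hx⟩, hq.2⟩)
  refine norm_sgrad_le_of_local ((hu.contDiff_space q.2).of_le (by norm_num)) hNpos.le ?_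
  have hcont : Continuous fun y : Fin n → ℝ => euclLen (q.1 - y) := by fun_prop
  filter_upwards [hΩo.mem_nhds hxΩ, (hcont.tendsto q.1).eventually_lt_const
    (by simpa using (by positivity : 0 < 4 * K / N))] with y hy hy'
  refine (hest q.1 hq.1 y (subset_closure hy) q.2 hq.2 hy'.le).trans ?_
  rw [profile]
  have : 0 ≤ N / (3 * √(4 * K / N)) * (euclLen (q.1 - y) * √(euclLen (q.1 - y))) :=
    mul_nonneg (by positivity) (mul_nonneg (euclLen_nonneg _) (Real.sqrt_nonneg _))
  linarith

end ParabolicHessian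
end
end
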